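/- arXiv:2106.16017 — 5 statements merged into one kernel-verified Lean document; each statement's English description precedes it below -/
import Mathlib

section
/- Let T ∈ ℝ and n ≥ 1. Fix a ∈ B_T and a kernel K with λ(K) < 1, and let x_{a,K} ∈ B_T denote the unique bounded solution of the Volterra integral equation at infinity with data (a, K). Then for every ε > 0 there exists δ > 0 such that for every a' ∈ B_T and every kernel K' with λ(K') < 1, if ‖a' − a‖_∞ < δ and d_𝒦(K', K) < δ, then ‖x_{a',K'} − x_{a,K}‖_∞ < ε. That is, the map (a, K) ↦ x_{a,K} is continuous. -/
open MeasureTheory Set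

section Volterra

open Filter Topology

variable {E : Type*} [NormedAddCommGroup E] [NormedSpace ℂ E] {T : ℝ} {K : ℝ → ℝ → E →L[ℂ] E}

theorem aestronglyMeasurable_kernel
    (hK : ContinuousOn (fun p : ℝ × ℝ => K p.1 p.2) {p : ℝ × ℝ | T ≤ p.1 ∧ p.1 ≤ p.2})
    {t : ℝ} (ht : T ≤ t) : AEStronglyMeasurable (K t) (volume.restrict (Ioi t)) := by
  refine ContinuousOn.aestronglyMeasurable ?_ measurableSet_Ioi
  exact hK.comp (f := fun s : ℝ => (t, s)) (by fun_prop) fun s hs => ⟨ht, le_of_lt hs⟩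

theorem integrableOn_kernel_apply {x : ℝ → E} {M t : ℝ}
    (hKt : IntegrableOn (fun s => ‖K t s‖) (Ioi t))
    (hx : ∀ s ∈ Ioi t, ‖x s‖ ≤ M)
    (hm : AEStronglyMeasurable (fun s => K t s (x s)) (volume.restrict (Ioi t))) :
    IntegrableOn (fun s => K t s (x s)) (Ioi t) := by
  refine Integrable.mono' (hKt.mul_const M) hm ?_
  refine ae_restrict_of_forall_mem measurableSet_Ioi fun s hs => ?_
  exact ((K t s).le_opNorm _).trans (by gcongr; exact hx s hs)

theorem tendsto_kernel_apply
    (hK : ContinuousOn (fun p : ℝ × ℝ => K p.1 p.2) {p : ℝ × ℝ | T ≤ p.1 ∧ p.1 ≤ p.2})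
    {ι : Type*} {l : Filter ι} {u : ι → ℝ} {t s : ℝ} (ht : T ≤ t) (hts : t < s)
    (hu : Tendsto u l (𝓝 t)) (huT : ∀ᶠ k in l, T ≤ u k) (v : E) :
    Tendsto (fun k => K (u k) s v) l (𝓝 (K t s v)) := by
  have h1 : Tendsto (fun k => (u k, s)) l
      (𝓝[{p : ℝ × ℝ | T ≤ p.1 ∧ p.1 ≤ p.2}] (t, s)) := by
    refine tendsto_nhdsWithin_iff.2 ⟨hu.prodMk_nhds tendsto_const_nhds, ?_⟩
    filter_upwards [huT, hu.eventually_lt_const hts] with k h1 h2 using ⟨h1, h2.le⟩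
  have h2 : Tendsto (fun k => K (u k) s) l (𝓝 (K t s)) :=
    (hK (t, s) ⟨ht, hts.le⟩).tendsto.comp h1
  exact ((ContinuousLinearMap.apply ℂ E v).continuous.tendsto _).comp h2

/-- The set of times at which the integrand of the Volterra operator is measurable is closed. -/
theorem isClosed_measurable_times
    (hK : ContinuousOn (fun p : ℝ × ℝ => K p.1 p.2) {p : ℝ × ℝ | T ≤ p.1 ∧ p.1 ≤ p.2})
    (x : ℝ → E) :
    IsClosed {t | T ≤ t ∧
      AEStronglyMeasurable (fun s => K t s (x s)) (volume.restrict (Ioi t))} := by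
  refine IsSeqClosed.isClosed fun u t hu hut => ?_
  have ht : T ≤ t := ge_of_tendsto' hut fun k => (hu k).1
  refine ⟨ht, ?_⟩
  refine aestronglyMeasurable_of_tendsto_ae atTop
    (f := fun k => (Ioi (u k)).indicator fun s => K (u k) s (x s))
    (fun k => ((aestronglyMeasurable_indicator_iff measurableSet_Ioi).2 (hu k).2).restrict) ?_
  refine ae_restrict_of_forall_mem measurableSet_Ioi fun s hs => ?_
  refine (tendsto_kernel_apply hK ht hs hut (.of_forall fun k => (hu k).1) (x s)).congr' ?_
  filter_upwards [hut.eventually_lt_const hs] with k hk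
  rw [indicator_of_mem (show s ∈ Ioi (u k) from hk)]

theorem exists_kernel_bound
    (hK : ContinuousOn (fun p : ℝ × ℝ => K p.1 p.2) {p : ℝ × ℝ | T ≤ p.1 ∧ p.1 ≤ p.2})
    (m : ℝ) : ∃ C, ∀ t s, T ≤ t → t ≤ s → s ≤ m → ‖K t s‖ ≤ C := by
  have hc : IsCompact ((Icc T m ×ˢ Icc T m) ∩ {p : ℝ × ℝ | p.1 ≤ p.2}) :=
    (isCompact_Icc.prod isCompact_Icc).inter_right (isClosed_le continuous_fst continuous_snd)
  obtain ⟨C, hC⟩ := hc.exists_bound_of_continuousOn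
    (hK.mono fun p hp => ⟨hp.1.1.1, hp.2⟩)
  exact ⟨C, fun t s h1 h2 h3 =>
    hC (t, s) ⟨⟨⟨h1, h2.trans h3⟩, ⟨h1.trans h2, h3⟩⟩, h2⟩⟩

theorem continuousOn_truncated_integral
    (hK : ContinuousOn (fun p : ℝ × ℝ => K p.1 p.2) {p : ℝ × ℝ | T ≤ p.1 ∧ p.1 ≤ p.2})
    {x : ℝ → E} {M : ℝ} (hx : ∀ t ∈ Ici T, ‖x t‖ ≤ M) (m : ℝ) :
    ContinuousOn (fun t => ∫ s, (Ioc t m).indicator (fun s => K t s (x s)) s)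
      {t | T ≤ t ∧
        AEStronglyMeasurable (fun s => K t s (x s)) (volume.restrict (Ioi t))} := by
  intro t₀ ht₀
  obtain ⟨C, hC⟩ := exists_kernel_bound hK m
  refine tendsto_integral_filter_of_dominated_convergence
    ((Ioc T m).indicator fun _ => C * M) ?_ ?_ ?_ ?_
  · filter_upwards [self_mem_nhdsWithin] with t ht
    exact (aestronglyMeasurable_indicator_iff measurableSet_Ioc).2
      (ht.2.mono_set Ioc_subset_Ioi_self)
  · filter_upwards [self_mem_nhdsWithin] with t ht
    refine .of_forall fun s => ?_
    by_cases hs : s ∈ Ioc t m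
    · have hsT : s ∈ Ioc T m := ⟨ht.1.trans_lt hs.1, hs.2⟩
      rw [indicator_of_mem hs, indicator_of_mem hsT]
      have h1 := hC t s ht.1 hs.1.le hs.2
      exact ((K t s).le_opNorm _).trans
        (mul_le_mul h1 (hx s hsT.1.le) (norm_nonneg _) ((norm_nonneg _).trans h1))
    · rw [indicator_of_notMem hs, norm_zero]
      refine indicator_nonneg (fun s hs => ?_) s
      exact mul_nonneg ((norm_nonneg _).trans (hC s s hs.1.le le_rfl hs.2))
        ((norm_nonneg _).trans (hx s hs.1.le))
  · exact (integrable_indicator_iff measurableSet_Ioc).2 (integrableOn_const (by simp))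
  · have hne : ∀ᵐ s : ℝ, s ≠ t₀ := by simp [ae_iff]
    filter_upwards [hne] with s hs
    have hid : Tendsto (fun t : ℝ => t) (𝓝[{t | T ≤ t ∧
        AEStronglyMeasurable (fun s => K t s (x s)) (volume.restrict (Ioi t))}] t₀) (𝓝 t₀) :=
      tendsto_id.mono_left nhdsWithin_le_nhds
    rcases lt_or_gt_of_ne hs with h | h
    · rw [indicator_of_notMem fun h' => h.not_gt h'.1]
      refine tendsto_const_nhds.congr' ?_
      filter_upwards [hid.eventually_const_lt h] with t ht
      rw [indicator_of_notMem fun h' => ht.not_gt h'.1]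
    · by_cases hm : s ≤ m
      · rw [indicator_of_mem (show s ∈ Ioc t₀ m from ⟨h, hm⟩)]
        refine (tendsto_kernel_apply hK ht₀.1 h hid ?_ (x s)).congr' ?_
        · filter_upwards [self_mem_nhdsWithin] with t ht using ht.1
        · filter_upwards [hid.eventually_lt_const h] with t ht
          rw [indicator_of_mem (show s ∈ Ioc t m from ⟨ht, hm⟩)]
      · rw [indicator_of_notMem fun h' => hm h'.2]
        refine tendsto_const_nhds.congr fun t => ?_
        rw [indicator_of_notMem fun h' => hm h'.2]

theorem tendsto_truncated_integral {f : ℝ → E} {t : ℝ} (hf : IntegrableOn f (Ioi t)) :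
    Tendsto (fun m : ℕ => ∫ s, (Ioc t m).indicator f s) atTop (𝓝 (∫ s in Ioi t, f s)) := by
  have h := (intervalIntegral_tendsto_integral_Ioi t hf tendsto_natCast_atTop_atTop)
  refine h.congr' ?_
  filter_upwards [tendsto_natCast_atTop_atTop.eventually_ge_atTop t] with m hm
  rw [intervalIntegral.integral_of_le hm, integral_indicator measurableSet_Ioc]

/-- A bounded solution is automatically measurable, even though the integral in the equation is
zero by convention wherever the integrand fails to be integrable. -/
theorem aestronglyMeasurable_of_volterra {a x : ℝ → E} {M : ℝ}
    (ha : ContinuousOn a (Ici T))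
    (hK : ContinuousOn (fun p : ℝ × ℝ => K p.1 p.2) {p : ℝ × ℝ | T ≤ p.1 ∧ p.1 ≤ p.2})
    (hK_int : ∀ t ∈ Ici T, IntegrableOn (fun s => ‖K t s‖) (Ioi t))
    (hx : ∀ t ∈ Ici T, ‖x t‖ ≤ M)
    (hx_eq : ∀ t ∈ Ici T, x t = a t - ∫ s in Ioi t, K t s (x s)) :
    AEStronglyMeasurable x (volume.restrict (Ici T)) := by
  set S := {t | T ≤ t ∧
    AEStronglyMeasurable (fun s => K t s (x s)) (volume.restrict (Ioi t))}
  have hSm : MeasurableSet S := (isClosed_measurable_times hK x).measurableSet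
  have hST : S ⊆ Ici T := fun t ht => ht.1
  have ham : AEStronglyMeasurable a (volume.restrict (Ici T)) :=
    ha.aestronglyMeasurable measurableSet_Ici
  have hG : AEStronglyMeasurable (fun t => ∫ s in Ioi t, K t s (x s)) (volume.restrict S) := by
    refine aestronglyMeasurable_of_tendsto_ae atTop
      (f := fun (m : ℕ) (t : ℝ) => ∫ s, (Ioc t m).indicator (fun s => K t s (x s)) s)
      (fun m => (continuousOn_truncated_integral hK hx m).aestronglyMeasurable hSm) ?_
    refine ae_restrict_of_forall_mem hSm fun t ht => tendsto_truncated_integral ?_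
    exact integrableOn_kernel_apply (hK_int t ht.1)
      (fun s hs => hx s (ht.1.trans (le_of_lt hs))) ht.2
  have h1 : AEStronglyMeasurable x (volume.restrict S) := by
    refine ((ham.mono_set hST).sub hG).congr ?_
    exact ae_restrict_of_forall_mem hSm fun t ht => (hx_eq t ht.1).symm
  have h2 : AEStronglyMeasurable x (volume.restrict (Ici T \ S)) := by
    refine (ham.mono_set sdiff_subset).congr ?_
    refine ae_restrict_of_forall_mem (measurableSet_Ici.diff hSm) fun t ht => ?_
    have hn : ¬ Integrable (fun s => K t s (x s)) (volume.restrict (Ioi t)) :=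
      fun h => ht.2 ⟨ht.1, h.1⟩
    rw [hx_eq t ht.1, integral_undef hn, sub_zero]
  rw [← union_sdiff_cancel hST]
  exact aestronglyMeasurable_union_iff.2 ⟨h1, h2⟩

theorem integrableOn_of_volterra {a x : ℝ → E} {M : ℝ}
    (ha : ContinuousOn a (Ici T))
    (hK : ContinuousOn (fun p : ℝ × ℝ => K p.1 p.2) {p : ℝ × ℝ | T ≤ p.1 ∧ p.1 ≤ p.2})
    (hK_int : ∀ t ∈ Ici T, IntegrableOn (fun s => ‖K t s‖) (Ioi t))
    (hx : ∀ t ∈ Ici T, ‖x t‖ ≤ M)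
    (hx_eq : ∀ t ∈ Ici T, x t = a t - ∫ s in Ioi t, K t s (x s)) {t : ℝ} (ht : T ≤ t) :
    IntegrableOn (fun s => K t s (x s)) (Ioi t) := by
  have hm := aestronglyMeasurable_of_volterra ha hK hK_int hx hx_eq
  refine integrableOn_kernel_apply (hK_int t ht) (fun s hs => hx s (ht.trans (le_of_lt hs))) ?_
  have hsub : Ioi t ⊆ Ici T := fun s hs => ht.trans (le_of_lt hs)
  exact (ContinuousLinearMap.id ℂ (E →L[ℂ] E)).aestronglyMeasurable_comp₂
    (aestronglyMeasurable_kernel hK ht) (hm.mono_set hsub)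

/-- The basic estimate on the difference of two Volterra integrals. -/
theorem norm_integral_sub_integral_le {K' : ℝ → ℝ → E →L[ℂ] E} {x x' : ℝ → E} {t M D : ℝ}
    (hd : IntegrableOn (fun s => ‖K' t s - K t s‖) (Ioi t))
    (hK : IntegrableOn (fun s => ‖K t s‖) (Ioi t))
    (hi : IntegrableOn (fun s => K t s (x s)) (Ioi t))
    (hi' : IntegrableOn (fun s => K' t s (x' s)) (Ioi t))
    (hx : ∀ s ∈ Ioi t, ‖x s‖ ≤ M) (hD : ∀ s ∈ Ioi t, ‖x' s - x s‖ ≤ D) :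
    ‖(∫ s in Ioi t, K' t s (x' s)) - ∫ s in Ioi t, K t s (x s)‖ ≤
      (∫ s in Ioi t, ‖K' t s - K t s‖) * (M + D) + (∫ s in Ioi t, ‖K t s‖) * D := by
  rw [← integral_sub hi' hi, ← integral_mul_const, ← integral_mul_const,
    ← integral_add (hd.mul_const _) (hK.mul_const _)]
  refine norm_integral_le_of_norm_le ((hd.mul_const _).add (hK.mul_const _)) ?_
  refine ae_restrict_of_forall_mem measurableSet_Ioi fun s hs => ?_
  have e : K' t s (x' s) - K t s (x s) = (K' t s - K t s) (x' s) + K t s (x' s - x s) := by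
    simp
  have hx' : ‖x' s‖ ≤ M + D := by
    calc ‖x' s‖ = ‖x s + (x' s - x s)‖ := by simp
      _ ≤ ‖x s‖ + ‖x' s - x s‖ := norm_add_le _ _
      _ ≤ M + D := add_le_add (hx s hs) (hD s hs)
  rw [e]
  refine (norm_add_le _ _).trans (add_le_add ?_ ?_)
  · exact ((K' t s - K t s).le_opNorm _).trans (by gcongr)
  · exact ((K t s).le_opNorm _).trans (by gcongr; exact hD s hs)

end Volterra

/-- Continuous dependence, Theorem 5.7 of the paper. Fix data
`(a, K)` with `λ(K) < 1` and let `x` be the unique bounded solution of the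
Volterra integral equation at infinity. Then for every `ε > 0` there is `δ > 0`
such that whenever `(a', K')` is another admissible data set with
`‖a' − a‖_∞ < δ` and `d_𝒦(K', K) < δ`, the corresponding bounded solution `x'`
satisfies `‖x' − x‖_∞ < ε`; i.e. `(a, K) ↦ x_{a,K}` is continuous. -/
theorem volterra_at_infinity_continuous_dependence
    (T : ℝ) (n : ℕ) (hn : 1 ≤ n)
    (a : ℝ → EuclideanSpace ℂ (Fin n))
    (ha_cont : ContinuousOn a (Ici T))
    (ha_bdd : ∃ M : ℝ, ∀ t ∈ Ici T, ‖a t‖ ≤ M)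
    (K : ℝ → ℝ → EuclideanSpace ℂ (Fin n) →L[ℂ] EuclideanSpace ℂ (Fin n))
    (hK_cont : ContinuousOn (fun p : ℝ × ℝ => K p.1 p.2) {p : ℝ × ℝ | T ≤ p.1 ∧ p.1 ≤ p.2})
    (hK_int : ∀ t ∈ Ici T, IntegrableOn (fun s => ‖K t s‖) (Ioi t))
    (lam : ℝ) (hlam : lam < 1)
    (hK_lam : ∀ t ∈ Ici T, (∫ s in Ioi t, ‖K t s‖) ≤ lam)
    (x : ℝ → EuclideanSpace ℂ (Fin n))
    (hx_bdd : ∃ M : ℝ, ∀ t ∈ Ici T, ‖x t‖ ≤ M)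
    (hx_cont : ContinuousOn x (Ici T))
    (hx_eq : ∀ t ∈ Ici T, x t = a t - ∫ s in Ioi t, K t s (x s)) :
    ∀ ε > (0 : ℝ), ∃ δ > (0 : ℝ),
      ∀ (a' : ℝ → EuclideanSpace ℂ (Fin n))
        (K' : ℝ → ℝ → EuclideanSpace ℂ (Fin n) →L[ℂ] EuclideanSpace ℂ (Fin n))
        (lam' : ℝ) (x' : ℝ → EuclideanSpace ℂ (Fin n)),
        ContinuousOn a' (Ici T) →
        (∃ M : ℝ, ∀ t ∈ Ici T, ‖a' t‖ ≤ M) →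
        ContinuousOn (fun p : ℝ × ℝ => K' p.1 p.2) {p : ℝ × ℝ | T ≤ p.1 ∧ p.1 ≤ p.2} →
        (∀ t ∈ Ici T, IntegrableOn (fun s => ‖K' t s‖) (Ioi t)) →
        lam' < 1 →
        (∀ t ∈ Ici T, (∫ s in Ioi t, ‖K' t s‖) ≤ lam') →
        (∃ M : ℝ, ∀ t ∈ Ici T, ‖x' t‖ ≤ M) →
        (∀ t ∈ Ici T, x' t = a' t - ∫ s in Ioi t, K' t s (x' s)) →
        (∀ t ∈ Ici T, ‖a' t - a t‖ < δ) →
        (∀ t ∈ Ici T, (∫ s in Ioi t, ‖K' t s - K t s‖) < δ) →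
        ∀ t ∈ Ici T, ‖x' t - x t‖ < ε := by
  intro ε hε
  obtain ⟨M, hM⟩ := hx_bdd
  have hM0 : 0 ≤ M := (norm_nonneg _).trans (hM T self_mem_Ici)
  have hl : 0 < 1 - lam := sub_pos.2 hlam
  refine ⟨min ((1 - lam) / 2) (ε * (1 - lam) / (4 * (1 + M))), by positivity, ?_⟩
  set δ := min ((1 - lam) / 2) (ε * (1 - lam) / (4 * (1 + M)))
  intro a' K' lam' x' ha' _ hK' hK'_int _ _ ⟨M', hM'⟩ hx'_eq hda hdK
  have hδ1 : δ ≤ (1 - lam) / 2 := min_le_left _ _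
  have hδ2 : δ * (4 * (1 + M)) ≤ ε * (1 - lam) :=
    (le_div_iff₀ (by positivity)).1 (min_le_right _ _)
  have hbdd : BddAbove ((fun t => ‖x' t - x t‖) '' Ici T) := by
    refine ⟨M' + M, ?_⟩
    rintro _ ⟨t, ht, rfl⟩
    exact (norm_sub_le _ _).trans (add_le_add (hM' t ht) (hM t ht))
  set D := sSup ((fun t => ‖x' t - x t‖) '' Ici T)
  have hD : ∀ t ∈ Ici T, ‖x' t - x t‖ ≤ D := fun t ht => le_csSup hbdd ⟨t, ht, rfl⟩
  have hD0 : 0 ≤ D := (norm_nonneg _).trans (hD T self_mem_Ici)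
  have hmain : D ≤ δ + (δ * (M + D) + lam * D) := by
    refine csSup_le (nonempty_Ici.image _) ?_
    rintro _ ⟨t, ht, rfl⟩
    have hsub : ∀ s ∈ Ioi t, s ∈ Ici T := fun s hs => (mem_Ici.1 ht).trans (le_of_lt hs)
    have hd : IntegrableOn (fun s => ‖K' t s - K t s‖) (Ioi t) := by
      refine Integrable.mono' ((hK'_int t ht).add (hK_int t ht))
        ((aestronglyMeasurable_kernel hK' ht).sub (aestronglyMeasurable_kernel hK_cont ht)).norm
        (.of_forall fun s => ?_)
      rw [norm_norm]
      exact norm_sub_le _ _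
    have key := norm_integral_sub_integral_le hd (hK_int t ht)
      (integrableOn_of_volterra ha_cont hK_cont hK_int hM hx_eq ht)
      (integrableOn_of_volterra ha' hK' hK'_int hM' hx'_eq ht)
      (fun s hs => hM s (hsub s hs)) (fun s hs => hD s (hsub s hs))
    have e : x' t - x t = (a' t - a t) -
        ((∫ s in Ioi t, K' t s (x' s)) - ∫ s in Ioi t, K t s (x s)) := by
      rw [hx'_eq t ht, hx_eq t ht]
      abel
    calc ‖x' t - x t‖ ≤ ‖a' t - a t‖ +
          ‖(∫ s in Ioi t, K' t s (x' s)) - ∫ s in Ioi t, K t s (x s)‖ := by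
          rw [e]; exact norm_sub_le _ _
      _ ≤ δ + (δ * (M + D) + lam * D) := by
          refine add_le_add (hda t ht).le (key.trans (add_le_add ?_ ?_))
          · exact mul_le_mul_of_nonneg_right (hdK t ht).le (by positivity)
          · exact mul_le_mul_of_nonneg_right (hK_lam t ht) hD0
  have hDε : D < ε := by
    have h1 : δ * D ≤ (1 - lam) / 2 * D := mul_le_mul_of_nonneg_right hδ1 hD0
    have h2 : (1 - lam) * D ≤ (1 - lam) * (ε / 2) := by linarith
    linarith [le_of_mul_le_mul_left h2 hl]
  exact fun t ht => (hD t ht).trans_lt hDε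
end

section
/- Let T ∈ ℝ, n ≥ 1, and let U ⊆ ℝ be open. Let a : [T,∞) × U → ℂⁿ be such that a(·,ε) ∈ B_T for every ε ∈ U and the map ε ↦ a(·,ε) is continuous from U to (B_T, ‖·‖_∞). Let K : Δ(T) × U → Mₙ(ℂ) be such that each K_ε := K(·,·,ε) is a kernel with λ(K_ε) < 1 and the map ε ↦ K_ε is continuous with respect to d_𝒦. For each ε ∈ U let x_ε ∈ B_T be the unique bounded solution of the Volterra integral equation at infinity with data (a(·,ε), K_ε). Then the function x : [T,∞) × U → ℂⁿ defined by x(t, ε) := x_ε(t) is jointly continuous in (t, ε). -/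
open MeasureTheory Set

section

variable {E : Type*} [NormedAddCommGroup E] [NormedSpace ℂ E]

/-- Applying an integrable, continuous operator-valued function to a bounded continuous function
gives an integrable function. -/
lemma integrableOn_clm_apply_of_bounded {t M : ℝ} {k : ℝ → E →L[ℂ] E} {v : ℝ → E}
    (hk : ContinuousOn k (Ioi t)) (hk_int : IntegrableOn (fun s => ‖k s‖) (Ioi t))
    (hv : ContinuousOn v (Ioi t)) (hv_bdd : ∀ s ∈ Ioi t, ‖v s‖ ≤ M) :
    IntegrableOn (fun s => k s (v s)) (Ioi t) := by
  refine Integrable.mono' (hk_int.mul_const M)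
    ((hk.clm_apply hv).aestronglyMeasurable measurableSet_Ioi) ?_
  filter_upwards [ae_restrict_mem measurableSet_Ioi] with s hs
  exact (k s).le_opNorm_of_le (hv_bdd s hs)

/-- The norm of the integral of `k s (v s)` is at most the integral of `‖k s‖` times a bound
for `v`. -/
lemma norm_setIntegral_clm_apply_le {t M : ℝ} {k : ℝ → E →L[ℂ] E} {v : ℝ → E}
    (hk_int : IntegrableOn (fun s => ‖k s‖) (Ioi t)) (hv_bdd : ∀ s ∈ Ioi t, ‖v s‖ ≤ M) :
    ‖∫ s in Ioi t, k s (v s)‖ ≤ (∫ s in Ioi t, ‖k s‖) * M := by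
  rw [← integral_mul_const]
  refine norm_integral_le_of_norm_le (hk_int.mul_const M) ?_
  filter_upwards [ae_restrict_mem measurableSet_Ioi] with s hs
  exact (k s).le_opNorm_of_le (hv_bdd s hs)

/-- Stability of bounded solutions of the Volterra equation at infinity: if the data differ by at
most `η` and the contraction constant of the first kernel is at most `l`, then the distance `S`
between the solutions satisfies `S ≤ η + η * (M + S) + l * S`, where `M` bounds the first
solution. -/
lemma exists_volterra_dist_bound {T l η M M' : ℝ} {a a' x x' : ℝ → E} {K K' : ℝ → ℝ → E →L[ℂ] E}
    (ha : ∀ t ∈ Ici T, ‖a' t - a t‖ ≤ η)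
    (hK_cont : ∀ t ∈ Ici T, ContinuousOn (K t) (Ioi t))
    (hK_cont' : ∀ t ∈ Ici T, ContinuousOn (K' t) (Ioi t))
    (hK_int : ∀ t ∈ Ici T, IntegrableOn (fun s => ‖K t s‖) (Ioi t))
    (hK_int' : ∀ t ∈ Ici T, IntegrableOn (fun s => ‖K' t s‖) (Ioi t))
    (hK_lam : ∀ t ∈ Ici T, (∫ s in Ioi t, ‖K t s‖) ≤ l)
    (hK : ∀ t ∈ Ici T, (∫ s in Ioi t, ‖K' t s - K t s‖) ≤ η)
    (hx_bdd : ∀ t ∈ Ici T, ‖x t‖ ≤ M) (hx_bdd' : ∀ t ∈ Ici T, ‖x' t‖ ≤ M')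
    (hx_cont : ContinuousOn x (Ici T)) (hx_cont' : ContinuousOn x' (Ici T))
    (hx_eq : ∀ t ∈ Ici T, x t = a t - ∫ s in Ioi t, K t s (x s))
    (hx_eq' : ∀ t ∈ Ici T, x' t = a' t - ∫ s in Ioi t, K' t s (x' s)) :
    ∃ S, (∀ t ∈ Ici T, ‖x' t - x t‖ ≤ S) ∧ S ≤ η + η * (M + S) + l * S := by
  have hbdd : BddAbove (range fun t : Ici T => ‖x' t - x t‖) := by
    refine ⟨M' + M, ?_⟩
    rintro _ ⟨t, rfl⟩
    exact (norm_sub_le _ _).trans (add_le_add (hx_bdd' t t.2) (hx_bdd t t.2))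
  set S := ⨆ t : Ici T, ‖x' t - x t‖
  have hS : ∀ t ∈ Ici T, ‖x' t - x t‖ ≤ S := fun t ht => le_ciSup hbdd ⟨t, ht⟩
  have hS0 : 0 ≤ S := (norm_nonneg _).trans (hS T self_mem_Ici)
  have hM0 : 0 ≤ M := (norm_nonneg _).trans (hx_bdd T self_mem_Ici)
  have : Nonempty (Ici T) := ⟨⟨T, self_mem_Ici⟩⟩
  refine ⟨S, hS, ciSup_le ?_⟩
  rintro ⟨t, ht⟩
  have hsub : Ioi t ⊆ Ici T := fun s hs => mem_Ici.2 (le_trans ht (le_of_lt hs))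
  have hd_cont : ContinuousOn (fun s => K' t s - K t s) (Ioi t) :=
    (hK_cont' t ht).sub (hK_cont t ht)
  have hd_int : IntegrableOn (fun s => ‖K' t s - K t s‖) (Ioi t) :=
    Integrable.mono' ((hK_int' t ht).add (hK_int t ht))
      (hd_cont.norm.aestronglyMeasurable measurableSet_Ioi)
      (.of_forall fun s => by simpa using norm_sub_le (K' t s) (K t s))
  have hx'_le : ∀ s ∈ Ioi t, ‖x' s‖ ≤ M + S := fun s hs => by
    have := norm_add_le (x s) (x' s - x s)
    rw [add_sub_cancel] at this
    linarith [hx_bdd s (hsub hs), hS s (hsub hs)]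
  have hx_c := hx_cont.mono hsub
  have hx_c' := hx_cont'.mono hsub
  have hS' : ∀ s ∈ Ioi t, ‖x' s - x s‖ ≤ S := fun s hs => hS s (hsub hs)
  have h1 := norm_setIntegral_clm_apply_le hd_int hx'_le
  have h2 := norm_setIntegral_clm_apply_le (hK_int t ht) hS'
  have key : x' t - x t = a' t - a t - (∫ s in Ioi t, (K' t s - K t s) (x' s))
      - ∫ s in Ioi t, K t s (x' s - x s) := by
    have e : (∫ s in Ioi t, K' t s (x' s)) - (∫ s in Ioi t, K t s (x s)) =
        (∫ s in Ioi t, (K' t s - K t s) (x' s)) + ∫ s in Ioi t, K t s (x' s - x s) := by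
      rw [← integral_sub
          (integrableOn_clm_apply_of_bounded (hK_cont' t ht) (hK_int' t ht) hx_c' hx'_le)
          (integrableOn_clm_apply_of_bounded (hK_cont t ht) (hK_int t ht) hx_c
            fun s hs => hx_bdd s (hsub hs)),
        ← integral_add (integrableOn_clm_apply_of_bounded hd_cont hd_int hx_c' hx'_le)
          (integrableOn_clm_apply_of_bounded (v := fun s => x' s - x s) (hK_cont t ht)
            (hK_int t ht) (hx_c'.sub hx_c) hS')]
      congr 1
      ext s
      simp
    rw [hx_eq t ht, hx_eq' t ht, sub_sub _ (∫ s in Ioi t, (K' t s - K t s) (x' s)), ← e]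
    abel
  rw [key]
  calc _ ≤ ‖a' t - a t‖ + ‖∫ s in Ioi t, (K' t s - K t s) (x' s)‖
        + ‖∫ s in Ioi t, K t s (x' s - x s)‖ :=
        (norm_sub_le _ _).trans (by gcongr; exact norm_sub_le _ _)
    _ ≤ η + η * (M + S) + l * S := by
        gcongr
        · exact ha t ht
        · exact h1.trans (by gcongr; exact hK t ht)
        · exact h2.trans (by gcongr; exact hK_lam t ht)

end

/-- Corollary 5.8 of the paper. If the data `(a(·,ε), K_ε)` of the
Volterra integral equation at infinity depends continuously on a parameter
`ε ∈ U ⊆ ℝ` (with `U` open), `a(·,ε) ∈ B_T` for every `ε`, each `K_ε` is a kernel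
with `λ(K_ε) < 1`, and `x(·,ε)` denotes the unique bounded solution for each `ε`,
then `(t, ε) ↦ x(t, ε)` is jointly continuous on `[T,∞) × U`. -/
theorem volterra_at_infinity_parameter_continuity
    (T : ℝ) (n : ℕ) (hn : 1 ≤ n) (U : Set ℝ) (hU : IsOpen U)
    (a : ℝ → ℝ → EuclideanSpace ℂ (Fin n))
    (ha_cont : ∀ ε ∈ U, ContinuousOn (fun t => a t ε) (Ici T))
    (ha_bdd : ∀ ε ∈ U, ∃ M : ℝ, ∀ t ∈ Ici T, ‖a t ε‖ ≤ M)
    -- the map `ε ↦ a(·,ε)` is continuous from `U` into `(B_T, ‖·‖_∞)`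
    (ha_param_cont : ∀ ε ∈ U, ∀ η > (0 : ℝ), ∃ δ > (0 : ℝ), ∀ ε' ∈ U,
      |ε' - ε| < δ → ∀ t ∈ Ici T, ‖a t ε' - a t ε‖ < η)
    (K : ℝ → ℝ → ℝ → EuclideanSpace ℂ (Fin n) →L[ℂ] EuclideanSpace ℂ (Fin n))
    (hK_cont : ∀ ε ∈ U,
      ContinuousOn (fun p : ℝ × ℝ => K p.1 p.2 ε) {p : ℝ × ℝ | T ≤ p.1 ∧ p.1 ≤ p.2})
    (hK_int : ∀ ε ∈ U, ∀ t ∈ Ici T, IntegrableOn (fun s => ‖K t s ε‖) (Ioi t))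
    (lam : ℝ → ℝ) (hlam : ∀ ε ∈ U, lam ε < 1)
    (hK_lam : ∀ ε ∈ U, ∀ t ∈ Ici T, (∫ s in Ioi t, ‖K t s ε‖) ≤ lam ε)
    -- the map `ε ↦ K_ε` is continuous with respect to `d_𝒦`
    (hK_param_cont : ∀ ε ∈ U, ∀ η > (0 : ℝ), ∃ δ > (0 : ℝ), ∀ ε' ∈ U,
      |ε' - ε| < δ → ∀ t ∈ Ici T, (∫ s in Ioi t, ‖K t s ε' - K t s ε‖) < η)
    (x : ℝ → ℝ → EuclideanSpace ℂ (Fin n))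
    (hx_bdd : ∀ ε ∈ U, ∃ M : ℝ, ∀ t ∈ Ici T, ‖x t ε‖ ≤ M)
    (hx_cont : ∀ ε ∈ U, ContinuousOn (fun t => x t ε) (Ici T))
    (hx_eq : ∀ ε ∈ U, ∀ t ∈ Ici T, x t ε = a t ε - ∫ s in Ioi t, K t s ε (x s ε)) :
    ContinuousOn (fun p : ℝ × ℝ => x p.1 p.2) (Ici T ×ˢ U) := by
  have hslice : ∀ ε ∈ U, ∀ t ∈ Ici T, ContinuousOn (fun s => K t s ε) (Ioi t) := fun ε hε t ht =>
    (hK_cont ε hε).comp (f := fun s => (t, s)) (by fun_prop) fun s hs => ⟨ht, le_of_lt hs⟩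
  rintro ⟨t₀, ε₀⟩ ⟨ht₀, hε₀⟩
  simp only at ht₀ hε₀
  obtain ⟨M, hM⟩ := hx_bdd ε₀ hε₀
  have hM0 : 0 ≤ M := (norm_nonneg _).trans (hM t₀ ht₀)
  rw [Metric.continuousWithinAt_iff]
  intro r hr
  have hc : 0 < 1 - lam ε₀ := sub_pos.2 (hlam ε₀ hε₀)
  obtain ⟨η, hη, hη₁, hη₂⟩ : ∃ η > 0, η ≤ (1 - lam ε₀) / 2 ∧
      η * (1 + M) ≤ (1 - lam ε₀) * r / 4 := by
    refine ⟨min ((1 - lam ε₀) / 2) ((1 - lam ε₀) * r / 4 / (1 + M)), by positivity,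
      min_le_left _ _, ?_⟩
    rw [← le_div_iff₀ (by positivity)]
    exact min_le_right _ _
  obtain ⟨δ₁, hδ₁, h₁⟩ := ha_param_cont ε₀ hε₀ η hη
  obtain ⟨δ₂, hδ₂, h₂⟩ := hK_param_cont ε₀ hε₀ η hη
  obtain ⟨δ₃, hδ₃, h₃⟩ := Metric.continuousWithinAt_iff.1 (hx_cont ε₀ hε₀ t₀ ht₀) (r / 2)
    (half_pos hr)
  refine ⟨min δ₁ (min δ₂ δ₃), by positivity, ?_⟩
  rintro ⟨t, ε⟩ ⟨ht, hε⟩ hd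
  simp only at ht hε
  rw [Prod.dist_eq, max_lt_iff, lt_min_iff, lt_min_iff, lt_min_iff, lt_min_iff] at hd
  obtain ⟨⟨-, -, hdt⟩, hd₁, hd₂, -⟩ := hd
  rw [Real.dist_eq] at hd₁ hd₂
  obtain ⟨M', hM'⟩ := hx_bdd ε hε
  obtain ⟨S, hS, hS_le⟩ := exists_volterra_dist_bound
    (fun t ht => (h₁ ε hε hd₁ t ht).le) (hslice ε₀ hε₀) (hslice ε hε) (hK_int ε₀ hε₀)
    (hK_int ε hε) (hK_lam ε₀ hε₀) (fun t ht => (h₂ ε hε hd₂ t ht).le) hM hM'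
    (hx_cont ε₀ hε₀) (hx_cont ε hε) (hx_eq ε₀ hε₀) (hx_eq ε hε)
  have hS0 : 0 ≤ S := (norm_nonneg _).trans (hS t₀ ht₀)
  have hSr : S ≤ r / 2 := by
    have := mul_le_mul_of_nonneg_right hη₁ hS0
    refine le_of_mul_le_mul_left ?_ hc
    linarith
  calc dist (x t ε) (x t₀ ε₀) ≤ dist (x t ε) (x t ε₀) + dist (x t ε₀) (x t₀ ε₀) :=
        dist_triangle _ _ _
    _ < r / 2 + r / 2 := by
        refine add_lt_add_of_le_of_lt ?_ (h₃ ht hdt)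
        rw [dist_eq_norm]
        exact (hS t ht).trans hSr
    _ = r := add_halves r
end

section
/- Let T ∈ ℝ, n ≥ 1, U ⊆ ℝ open, and let K : Δ(T) × U → Mₙ(ℂ) be of product type, K(t,s,ε) = A(t,s,ε)·B(s,ε), such that: each K_ε := K(·,·,ε) is a kernel with λ(K_ε) < 1; the partial derivative ∂_ε A exists and both ‖A‖ and ‖∂_ε A‖ are bounded by constants on Δ(T) × U; B is differentiable in ε; and B and ∂_ε B are integrally bounded. Then the map ε ↦ K_ε from U to the set of kernels is continuous with respect to d_𝒦. -/
open MeasureTheory Set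

/-- A family `B : [T,∞) × U → Mₙ(ℂ)` is *integrally bounded* if every `ε ∈ U` has an
open neighborhood `V ⊆ U` and a bounded nonnegative function `g` on `[T,∞)` with
finite integral such that `‖B(s,μ)‖ ≤ g(s)` for all `μ ∈ V` and `s ≥ T`. -/
def IntegrallyBounded (T : ℝ) (U : Set ℝ) {F : Type*} [NormedAddCommGroup F]
    (B : ℝ → ℝ → F) : Prop :=
  ∀ ε ∈ U, ∃ V : Set ℝ, IsOpen V ∧ ε ∈ V ∧ V ⊆ U ∧
    ∃ g : ℝ → ℝ, (∀ s ∈ Ici T, 0 ≤ g s) ∧ (∃ C : ℝ, ∀ s ∈ Ici T, g s ≤ C) ∧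
      IntegrableOn g (Ici T) ∧ ∀ μ ∈ V, ∀ s ∈ Ici T, ‖B s μ‖ ≤ g s

/-- Lemma 5.11 of the paper. For a kernel family of product type
`K(t,s,ε) = A(t,s,ε)·B(s,ε)` with each `K_ε` a kernel of contraction constant
`λ(K_ε) < 1`, `A` and `∂_ε A` uniformly bounded, `B` differentiable in `ε`, and
`B`, `∂_ε B` integrally bounded, the map `ε ↦ K_ε` is continuous with respect to
the kernel metric `d_𝒦(K₁,K₂) = sup_{t ≥ T} ∫_t^∞ ‖K₁(t,s) − K₂(t,s)‖ ds`. -/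
theorem product_type_kernel_family_continuous
    (T : ℝ) (n : ℕ) (hn : 1 ≤ n) (U : Set ℝ) (hU : IsOpen U)
    (A : ℝ → ℝ → ℝ → EuclideanSpace ℂ (Fin n) →L[ℂ] EuclideanSpace ℂ (Fin n))
    (B : ℝ → ℝ → EuclideanSpace ℂ (Fin n) →L[ℂ] EuclideanSpace ℂ (Fin n))
    -- each `K_ε` is a kernel with `λ(K_ε) < 1`
    (hK_cont : ∀ ε ∈ U, ContinuousOn
      (fun p : ℝ × ℝ => (A p.1 p.2 ε).comp (B p.2 ε)) {p : ℝ × ℝ | T ≤ p.1 ∧ p.1 ≤ p.2})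
    (hK_int : ∀ ε ∈ U, ∀ t ∈ Ici T,
      IntegrableOn (fun s => ‖(A t s ε).comp (B s ε)‖) (Ioi t))
    (lam : ℝ → ℝ) (hlam : ∀ ε ∈ U, lam ε < 1)
    (hK_lam : ∀ ε ∈ U, ∀ t ∈ Ici T, (∫ s in Ioi t, ‖(A t s ε).comp (B s ε)‖) ≤ lam ε)
    -- `∂_ε A` exists and `A`, `∂_ε A` are bounded by constants
    (A' : ℝ → ℝ → ℝ → EuclideanSpace ℂ (Fin n) →L[ℂ] EuclideanSpace ℂ (Fin n))
    (hA_deriv : ∀ t s : ℝ, T ≤ t → t ≤ s → ∀ ε ∈ U,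
      HasDerivWithinAt (fun e => A t s e) (A' t s ε) U ε)
    (CA : ℝ) (hA_bdd : ∀ t s : ℝ, T ≤ t → t ≤ s → ∀ ε ∈ U, ‖A t s ε‖ ≤ CA)
    (CA' : ℝ) (hA'_bdd : ∀ t s : ℝ, T ≤ t → t ≤ s → ∀ ε ∈ U, ‖A' t s ε‖ ≤ CA')
    -- `B` is differentiable in `ε`, and `B`, `∂_ε B` are integrally bounded
    (B' : ℝ → ℝ → EuclideanSpace ℂ (Fin n) →L[ℂ] EuclideanSpace ℂ (Fin n))
    (hB_deriv : ∀ s ∈ Ici T, ∀ ε ∈ U, HasDerivWithinAt (fun e => B s e) (B' s ε) U ε)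
    (hB_ib : IntegrallyBounded T U B) (hB'_ib : IntegrallyBounded T U B') :
    ∀ ε ∈ U, ∀ η > (0 : ℝ), ∃ δ > (0 : ℝ), ∀ ε' ∈ U, |ε' - ε| < δ →
      ∀ t ∈ Ici T,
        (∫ s in Ioi t, ‖(A t s ε').comp (B s ε') - (A t s ε).comp (B s ε)‖) < η := by
  intro ε hε η hη
  obtain ⟨V₁, hV₁, hεV₁, -, g₁, hg₁, -, hg₁i, hB⟩ := hB_ib ε hε
  obtain ⟨V₂, hV₂, hεV₂, hV₂U, g₂, hg₂, -, hg₂i, hB'⟩ := hB'_ib ε hε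
  obtain ⟨r, hr, hball⟩ := Metric.isOpen_iff.1 (hV₁.inter hV₂) ε ⟨hεV₁, hεV₂⟩
  have hballU : Metric.ball ε r ⊆ U := fun x hx => hV₂U (hball hx).2
  have hCA : 0 ≤ CA := (norm_nonneg _).trans (hA_bdd T T le_rfl le_rfl ε hε)
  have hCA' : 0 ≤ CA' := (norm_nonneg _).trans (hA'_bdd T T le_rfl le_rfl ε hε)
  set G : ℝ → ℝ := fun s => CA' * g₁ s + CA * g₂ s with hG
  have hGi : IntegrableOn G (Ici T) := (hg₁i.const_mul CA').add (hg₂i.const_mul CA)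
  have hG0 : ∀ s ∈ Ici T, 0 ≤ G s := fun s hs =>
    add_nonneg (mul_nonneg hCA' (hg₁ s hs)) (mul_nonneg hCA (hg₂ s hs))
  set M : ℝ := ∫ s in Ici T, G s with hM
  have hM0 : 0 ≤ M := setIntegral_nonneg measurableSet_Ici hG0
  refine ⟨min r (η / (M + 1)), by positivity, fun ε' hε' hd t ht => ?_⟩
  have hsub : Ioi t ⊆ Ici T := fun s hs => mem_Ici.2 (le_trans (mem_Ici.1 ht) (le_of_lt (mem_Ioi.1 hs)))
  have hε'b : ε' ∈ Metric.ball ε r := by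
    rw [Metric.mem_ball, Real.dist_eq]
    exact hd.trans_le (min_le_left _ _)
  have hεb : ε ∈ Metric.ball ε r := Metric.mem_ball_self hr
  have hpt : ∀ s ∈ Ioi t,
      ‖(A t s ε').comp (B s ε') - (A t s ε).comp (B s ε)‖ ≤ |ε' - ε| * G s := by
    intro s hs
    have hts : t ≤ s := le_of_lt hs
    have hTs : s ∈ Ici T := hsub hs
    have hAdiff : ‖A t s ε' - A t s ε‖ ≤ CA' * |ε' - ε| :=
      (convex_ball ε r).norm_image_sub_le_of_norm_hasDerivWithin_le
        (fun x hx => (hA_deriv t s ht hts x (hballU hx)).mono hballU)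
        (fun x hx => hA'_bdd t s ht hts x (hballU hx)) hεb hε'b
    have hBdiff : ‖B s ε' - B s ε‖ ≤ g₂ s * |ε' - ε| :=
      (convex_ball ε r).norm_image_sub_le_of_norm_hasDerivWithin_le
        (fun x hx => (hB_deriv s hTs x (hballU hx)).mono hballU)
        (fun x hx => hB' x (hball hx).2 s hTs) hεb hε'b
    have hsplit : (A t s ε').comp (B s ε') - (A t s ε).comp (B s ε)
        = (A t s ε' - A t s ε).comp (B s ε') + (A t s ε).comp (B s ε' - B s ε) := by
      simp [ContinuousLinearMap.sub_comp, ContinuousLinearMap.comp_sub]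
    calc ‖(A t s ε').comp (B s ε') - (A t s ε).comp (B s ε)‖
        ≤ ‖A t s ε' - A t s ε‖ * ‖B s ε'‖ + ‖A t s ε‖ * ‖B s ε' - B s ε‖ := by
          rw [hsplit]
          exact (norm_add_le _ _).trans
            (add_le_add (ContinuousLinearMap.opNorm_comp_le _ _)
              (ContinuousLinearMap.opNorm_comp_le _ _))
      _ ≤ (CA' * |ε' - ε|) * g₁ s + CA * (g₂ s * |ε' - ε|) := by
          gcongr
          · exact hB ε' (hball hε'b).1 s hTs
          · exact hA_bdd t s ht hts ε hε
      _ = |ε' - ε| * G s := by simp only [hG]; ring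
  calc (∫ s in Ioi t, ‖(A t s ε').comp (B s ε') - (A t s ε).comp (B s ε)‖)
      ≤ ∫ s in Ioi t, |ε' - ε| * G s :=
        integral_mono_of_nonneg (Filter.Eventually.of_forall fun s => norm_nonneg _)
          ((hGi.mono_set hsub).const_mul _)
          ((ae_restrict_iff' measurableSet_Ioi).2 (Filter.Eventually.of_forall hpt))
    _ = |ε' - ε| * ∫ s in Ioi t, G s := integral_const_mul _ _
    _ ≤ |ε' - ε| * M := by
        refine mul_le_mul_of_nonneg_left ?_ (abs_nonneg _)
        exact setIntegral_mono_set hGi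
          ((ae_restrict_iff' measurableSet_Ici).2 (Filter.Eventually.of_forall hG0))
          hsub.eventuallyLE
    _ ≤ |ε' - ε| * (M + 1) := by gcongr; linarith
    _ < η := (lt_div_iff₀ (by positivity)).1 (hd.trans_le (min_le_right _ _))
end

section
/- Let T ∈ ℝ, n ≥ 1, and U ⊆ ℝ open. Let a : [T,∞) × U → ℂⁿ be such that for every ε ∈ U the functions a(·,ε), ∂_ε a(·,ε) and ∂²_ε a(·,ε) exist, are continuous in t, and are uniformly bounded on [T,∞) × U. Let K : Δ(T) × U → Mₙ(ℂ) be continuous and of product type K(t,s,ε) = A(t,s,ε)·B(s,ε), where ∂_ε A and ∂²_ε A exist and ‖A‖, ‖∂_ε A‖, ‖∂²_ε A‖ are bounded by constants on Δ(T) × U, B is differentiable in ε, B and ∂_ε B are integrally bounded, and λ(K_ε) < 1 for every ε ∈ U. For each ε let x(·,ε) ∈ B_T be the unique bounded solution of the Volterra integral equation at infinity with data (a(·,ε), K_ε). Then for every (t, ε) the partial derivative ∂_ε x(t, ε) exists, ∂_ε x(·,ε) is a bounded continuous function of t, and it satisfies ∂_ε x(t, ε) = (∂_ε a(t, ε) −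 ∫_t^∞ ∂_ε K(t,s,ε)·x(s,ε) ds) − ∫_t^∞ K(t,s,ε)·∂_ε x(s,ε) ds. -/
open MeasureTheory Set

section VolterraAtInfinity

open Filter Topology

variable {E : Type*} [NormedAddCommGroup E]

/-- Membership in the domain `{(t, s) | T ≤ t ≤ s}` turns joint continuity of a kernel into
continuity in `s` on `(t, ∞)`. -/
lemma continuousOn_kernel_right {F : Type*} [TopologicalSpace F] {T t : ℝ} {K : ℝ → ℝ → F}
    (hK : ContinuousOn (fun p : ℝ × ℝ => K p.1 p.2) {p : ℝ × ℝ | T ≤ p.1 ∧ p.1 ≤ p.2})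
    (ht : T ≤ t) : ContinuousOn (fun s => K t s) (Ioi t) :=
  hK.comp (f := fun s => (t, s)) (by fun_prop) fun s hs => ⟨ht, le_of_lt hs⟩

/-- Joint continuity of a kernel on `{(t, s) | T ≤ t ≤ s}` gives continuity in `t` on `[T, s]`. -/
lemma continuousOn_kernel_left {F : Type*} [TopologicalSpace F] {T s : ℝ} {K : ℝ → ℝ → F}
    (hK : ContinuousOn (fun p : ℝ × ℝ => K p.1 p.2) {p : ℝ × ℝ | T ≤ p.1 ∧ p.1 ≤ p.2}) :
    ContinuousOn (fun t => K t s) (Icc T s) :=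
  hK.comp (f := fun t => (t, s)) (by fun_prop) fun _ ht => ht

/-- Continuity in the lower limit and a parameter of an integral over `(t, ∞)`. -/
lemma continuousOn_integral_Ioi [NormedSpace ℝ E] {T : ℝ} {F : ℝ → ℝ → E} {G : ℝ → ℝ}
    (hG : IntegrableOn G (Ici T))
    (hm : ∀ t, T ≤ t → AEStronglyMeasurable (F t) (volume.restrict (Ioi t)))
    (hb : ∀ t s, T ≤ t → t ≤ s → ‖F t s‖ ≤ G s)
    (hc : ∀ s, ContinuousOn (fun t => F t s) (Icc T s)) :
    ContinuousOn (fun t => ∫ s in Ioi t, F t s) (Ici T) := by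
  have h : ∀ t ∈ Ici T, ∫ s in Ioi t, F t s = ∫ s in Ioi T, (Ioi t).indicator (F t) s := by
    intro t ht
    rw [setIntegral_indicator measurableSet_Ioi, Ioi_inter_Ioi, max_eq_right ht]
  refine ContinuousOn.congr ?_ h
  intro t₀ ht₀
  refine continuousWithinAt_of_dominated (bound := G) ?_ ?_
    (hG.mono_set Ioi_subset_Ici_self) ?_
  · filter_upwards [self_mem_nhdsWithin] with t ht
    rw [aestronglyMeasurable_indicator_iff measurableSet_Ioi, Measure.restrict_restrict
      measurableSet_Ioi, Ioi_inter_Ioi, max_eq_left ht]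
    exact hm t ht
  · filter_upwards [self_mem_nhdsWithin] with t ht
    filter_upwards [ae_restrict_mem measurableSet_Ioi] with s hs
    by_cases hts : s ∈ Ioi t
    · rw [indicator_of_mem hts]
      exact hb t s ht (le_of_lt hts)
    · rw [indicator_of_notMem hts, norm_zero]
      exact (norm_nonneg _).trans (hb T s le_rfl (le_of_lt hs))
  · have hne : ∀ᵐ s : ℝ ∂volume.restrict (Ioi T), s ≠ t₀ :=
      ae_restrict_of_ae (Measure.ae_ne volume t₀)
    filter_upwards [hne] with s hs
    rcases lt_or_gt_of_ne hs with h | h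
    · refine (continuousWithinAt_const (b := (0 : E))).congr_of_eventuallyEq ?_
        (indicator_of_notMem (by simpa using h.le) _)
      filter_upwards [mem_nhdsWithin_of_mem_nhds (Ioi_mem_nhds h)] with t ht
      exact indicator_of_notMem (by simpa using le_of_lt ht) _
    · have hc' : ContinuousWithinAt (fun t => F t s) (Ici T) t₀ := by
        refine (hc s t₀ ⟨ht₀, h.le⟩).mono_of_mem_nhdsWithin ?_
        filter_upwards [self_mem_nhdsWithin, mem_nhdsWithin_of_mem_nhds (Iio_mem_nhds h)]
          with t h1 h2
        exact ⟨h1, le_of_lt h2⟩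
      refine hc'.congr_of_eventuallyEq ?_ (indicator_of_mem (by simpa using h) _)
      filter_upwards [mem_nhdsWithin_of_mem_nhds (Iio_mem_nhds h)] with t ht
      exact indicator_of_mem (by simpa using ht) _

/-- A bounded family satisfying a contraction-type self-improving bound is bounded by the
corresponding geometric limit. -/
lemma norm_le_div_of_self_bound {ι : Type*} {f : ι → E} {M p q : ℝ} (hq : q < 1)
    (hM : ∀ i, ‖f i‖ ≤ M)
    (hstep : ∀ D, (∀ i, ‖f i‖ ≤ D) → ∀ i, ‖f i‖ ≤ p + q * D) (i : ι) :
    ‖f i‖ ≤ p / (1 - q) := by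
  have hbdd : BddAbove (range fun i => ‖f i‖) := ⟨M, by rintro _ ⟨i, rfl⟩; exact hM i⟩
  have hle : ∀ i, ‖f i‖ ≤ ⨆ i, ‖f i‖ := fun i => le_ciSup hbdd i
  have : Nonempty ι := ⟨i⟩
  have hsup : (⨆ i, ‖f i‖) ≤ p + q * ⨆ i, ‖f i‖ := ciSup_le (hstep _ hle)
  rw [le_div_iff₀ (by linarith)]
  nlinarith [hle i]

variable [NormedSpace ℂ E]

/-- Bound for a Volterra integral with bounded density. -/
lemma norm_integral_kernel_le {t C lam : ℝ} {K : ℝ → E →L[ℂ] E} {φ : ℝ → E} (hC : 0 ≤ C)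
    (hKint : IntegrableOn (fun s => ‖K s‖) (Ioi t)) (hKlam : ∫ s in Ioi t, ‖K s‖ ≤ lam)
    (hφ : ∀ s, t ≤ s → ‖φ s‖ ≤ C) : ‖∫ s in Ioi t, K s (φ s)‖ ≤ lam * C := by
  have h1 : ‖∫ s in Ioi t, K s (φ s)‖ ≤ ∫ s in Ioi t, ‖K s‖ * C := by
    refine norm_integral_le_of_norm_le (hKint.mul_const C) ?_
    filter_upwards [ae_restrict_mem measurableSet_Ioi] with s hs
    exact (K s).le_of_opNorm_le_of_le le_rfl (hφ s (le_of_lt hs))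
  rw [integral_mul_const] at h1
  exact h1.trans (by gcongr)

/-- The integrand of a Volterra integral is integrable for bounded measurable densities. -/
lemma integrableOn_kernel_apply_s11 {t C : ℝ} {G : ℝ → ℝ} {K : ℝ → E →L[ℂ] E} {φ : ℝ → E}
    (hG : IntegrableOn G (Ioi t)) (hm : AEStronglyMeasurable K (volume.restrict (Ioi t)))
    (hφm : AEStronglyMeasurable φ (volume.restrict (Ioi t)))
    (hb : ∀ s, t ≤ s → ‖K s‖ ≤ G s) (hφ : ∀ s, t ≤ s → ‖φ s‖ ≤ C) :
    IntegrableOn (fun s => K s (φ s)) (Ioi t) := by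
  refine Integrable.mono' (hG.mul_const C)
    ((ContinuousLinearMap.id ℂ (E →L[ℂ] E)).aestronglyMeasurable_comp₂ hm hφm) ?_
  filter_upwards [ae_restrict_mem measurableSet_Ioi] with s hs
  exact (K s).le_of_opNorm_le_of_le (hb s (le_of_lt hs)) (hφ s (le_of_lt hs))

/-- A Volterra equation at infinity with contraction constant less than one and bounded continuous
inhomogeneity has a bounded continuous solution. -/
lemma exists_bounded_solution_volterra [CompleteSpace E] {T lam Mb : ℝ}
    {K : ℝ → ℝ → E →L[ℂ] E} {G : ℝ → ℝ} {b : ℝ → E}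
    (hK : ContinuousOn (fun p : ℝ × ℝ => K p.1 p.2) {p : ℝ × ℝ | T ≤ p.1 ∧ p.1 ≤ p.2})
    (hG : IntegrableOn G (Ici T)) (hKG : ∀ t s, T ≤ t → t ≤ s → ‖K t s‖ ≤ G s)
    (hKint : ∀ t, T ≤ t → IntegrableOn (fun s => ‖K t s‖) (Ioi t))
    (hlam : lam < 1) (hKlam : ∀ t, T ≤ t → ∫ s in Ioi t, ‖K t s‖ ≤ lam)
    (hb : ContinuousOn b (Ici T)) (hMb : ∀ t ∈ Ici T, ‖b t‖ ≤ Mb) :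
    ∃ y : ℝ → E, ContinuousOn y (Ici T) ∧ (∃ M : ℝ, ∀ t ∈ Ici T, ‖y t‖ ≤ M) ∧
      ∀ t ∈ Ici T, y t = b t - ∫ s in Ioi t, K t s (y s) := by
  have hlam0 : 0 ≤ lam :=
    (integral_nonneg fun s => norm_nonneg (K T s)).trans (hKlam T le_rfl)
  let ext (φ : BoundedContinuousFunction (Ici T) E) : ℝ → E := IciExtend φ
  have hext_cont : ∀ φ, Continuous (ext φ) := fun φ =>
    φ.continuous.comp (continuous_const.max continuous_id |>.subtype_mk _)
  have hext_bdd : ∀ φ s, ‖ext φ s‖ ≤ ‖φ‖ := fun φ s => φ.norm_coe_le_norm _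
  have hcont : ∀ φ, ContinuousOn (fun t => b t - ∫ s in Ioi t, K t s (ext φ s)) (Ici T) := by
    intro φ
    refine hb.sub (continuousOn_integral_Ioi (hG.mul_const ‖φ‖) ?_ ?_ ?_)
    · intro t ht
      exact ((continuousOn_kernel_right hK ht).clm_apply
        (hext_cont φ).continuousOn).aestronglyMeasurable measurableSet_Ioi
    · intro t s ht hs
      exact (K t s).le_of_opNorm_le_of_le (hKG t s ht hs) (hext_bdd φ s)
    · intro s
      exact (continuousOn_kernel_left hK).clm_apply continuousOn_const
  let Φ (φ : BoundedContinuousFunction (Ici T) E) : BoundedContinuousFunction (Ici T) E :=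
    BoundedContinuousFunction.ofNormedAddCommGroup
      (fun t : Ici T => b t - ∫ s in Ioi (t : ℝ), K t s (ext φ s))
      (continuousOn_iff_continuous_domRestrict.1 (hcont φ)) (Mb + lam * ‖φ‖)
      (fun t => (norm_sub_le _ _).trans (add_le_add (hMb t t.2)
        (norm_integral_kernel_le (norm_nonneg _) (hKint t t.2) (hKlam t t.2)
          fun s _ => hext_bdd φ s)))
  have hint : ∀ φ, ∀ t, T ≤ t → IntegrableOn (fun s => K t s (ext φ s)) (Ioi t) :=
    fun φ t ht => integrableOn_kernel_apply_s11
      (hG.mono_set (Ioi_subset_Ici_self.trans (Ici_subset_Ici.2 ht)))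
      ((continuousOn_kernel_right hK ht).aestronglyMeasurable measurableSet_Ioi)
      (hext_cont φ).aestronglyMeasurable (fun s hs => hKG t s ht hs) (fun s _ => hext_bdd φ s)
  have hΦ : ContractingWith ⟨lam, hlam0⟩ Φ := by
    refine ⟨by exact_mod_cast hlam, LipschitzWith.of_dist_le_mul fun φ ψ => ?_⟩
    rw [BoundedContinuousFunction.dist_le (by positivity)]
    intro t
    have h : Φ φ t - Φ ψ t = -∫ s in Ioi (t : ℝ), K t s (ext φ s - ext ψ s) := by
      have h2 : ∫ s in Ioi (t : ℝ), K t s (ext φ s - ext ψ s) =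
          (∫ s in Ioi (t : ℝ), K t s (ext φ s)) - ∫ s in Ioi (t : ℝ), K t s (ext ψ s) := by
        simp_rw [map_sub]
        exact integral_sub (hint φ t t.2) (hint ψ t t.2)
      rw [h2]
      change (b t - _) - (b t - _) = _
      abel
    rw [dist_eq_norm, h, norm_neg]
    refine norm_integral_kernel_le dist_nonneg (hKint t t.2) (hKlam t t.2) fun s _ => ?_
    rw [← dist_eq_norm]
    exact φ.dist_coe_le_dist _
  have hfix := hΦ.fixedPoint_isFixedPt
  set y := ContractingWith.fixedPoint Φ hΦ
  refine ⟨ext y, (hext_cont y).continuousOn, ⟨‖y‖, fun t _ => hext_bdd y t⟩, fun t ht => ?_⟩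
  have h : ext y t = y ⟨t, ht⟩ := IciExtend_of_mem _ ht
  rw [h]
  conv_lhs => rw [← hfix]
  rfl

/-- Bounded solutions of a Volterra equation at infinity with contraction constant less than one
tend to zero pointwise if the inhomogeneities do. -/
lemma tendsto_zero_of_volterra {T lam C : ℝ} {K : ℝ → ℝ → E →L[ℂ] E}
    {r w : ℕ → ℝ → E}
    (hKint : ∀ t, T ≤ t → IntegrableOn (fun s => ‖K t s‖) (Ioi t))
    (hlam : lam < 1) (hKlam : ∀ t, T ≤ t → ∫ s in Ioi t, ‖K t s‖ ≤ lam)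
    (hw_cont : ∀ k, ContinuousOn (w k) (Ici T)) (hw_bdd : ∀ k, ∀ t ∈ Ici T, ‖w k t‖ ≤ C)
    (hw : ∀ k, ∀ t ∈ Ici T, w k t = r k t - ∫ s in Ioi t, K t s (w k s))
    (hr : ∀ t ∈ Ici T, Tendsto (fun k => r k t) atTop (𝓝 0)) (t : ℝ) (ht : t ∈ Ici T) :
    Tendsto (fun k => w k t) atTop (𝓝 0) := by
  have hlam0 : 0 ≤ lam :=
    (integral_nonneg fun s => norm_nonneg (K T s)).trans (hKlam T le_rfl)
  have hC : 0 ≤ C := (norm_nonneg _).trans (hw_bdd 0 t ht)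
  have improve : ∀ N : ℕ, ∀ t ∈ Ici T,
      Tendsto (fun k => max (‖w k t‖ - lam ^ N * C) 0) atTop (𝓝 0) := by
    intro N
    induction N with
    | zero =>
      intro t ht
      refine tendsto_const_nhds.congr fun k => ?_
      rw [eq_comm, max_eq_right]
      simpa using hw_bdd k t ht
    | succ N ih =>
      intro t ht
      set c := lam ^ N * C with hc
      have hc0 : 0 ≤ c := by positivity
      let m (k : ℕ) (s : ℝ) : ℝ := max (‖w k s‖ - c) 0
      have hm0 : ∀ k s, 0 ≤ m k s := fun k s => le_max_right _ _
      have hmC : ∀ k s, t ≤ s → m k s ≤ C := fun k s hs =>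
        max_le (by linarith [hw_bdd k s (le_trans ht hs)]) hC
      have hw_le : ∀ k s, ‖w k s‖ ≤ c + m k s := fun k s => by
        linarith [le_max_left (‖w k s‖ - c) 0]
      have hmeas : ∀ k, AEStronglyMeasurable (fun s => ‖K t s‖ * m k s)
          (volume.restrict (Ioi t)) := by
        intro k
        refine (hKint t ht).aestronglyMeasurable.mul (ContinuousOn.aestronglyMeasurable ?_
          measurableSet_Ioi)
        have : ContinuousOn (w k) (Ioi t) :=
          (hw_cont k).mono (Ioi_subset_Ici_self.trans (Ici_subset_Ici.2 ht))
        exact (this.norm.sub continuousOn_const).sup continuousOn_const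
      have hbound : ∀ k, ∀ᵐ s ∂volume.restrict (Ioi t), ‖‖K t s‖ * m k s‖ ≤ ‖K t s‖ * C := by
        intro k
        filter_upwards [ae_restrict_mem measurableSet_Ioi] with s hs
        rw [Real.norm_of_nonneg (mul_nonneg (norm_nonneg _) (hm0 k s))]
        exact mul_le_mul_of_nonneg_left (hmC k s (le_of_lt hs)) (norm_nonneg _)
      have hlim : Tendsto (fun k => ∫ s in Ioi t, ‖K t s‖ * m k s) atTop (𝓝 0) := by
        have := tendsto_integral_of_dominated_convergence (f := fun _ => (0 : ℝ))
          (fun s => ‖K t s‖ * C) hmeas ((hKint t ht).mul_const C) hbound ?_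
        · simpa using this
        filter_upwards [ae_restrict_mem measurableSet_Ioi] with s hs
        simpa using (ih s (le_trans (mem_Ici.1 ht) (le_of_lt hs))).const_mul ‖K t s‖
      have hsum : Tendsto (fun k => ‖r k t‖ + ∫ s in Ioi t, ‖K t s‖ * m k s) atTop (𝓝 0) := by
        simpa using (hr t ht).norm.add hlim
      refine squeeze_zero (fun k => le_max_right _ _) (fun k => ?_) hsum
      have hmint : IntegrableOn (fun s => ‖K t s‖ * m k s) (Ioi t) :=
        ((hKint t ht).mul_const C).mono' (hmeas k) (hbound k)
      have h1 : ‖∫ s in Ioi t, K t s (w k s)‖ ≤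
          ∫ s in Ioi t, (‖K t s‖ * c + ‖K t s‖ * m k s) := by
        refine norm_integral_le_of_norm_le (((hKint t ht).mul_const c).add hmint) ?_
        filter_upwards with s
        rw [← mul_add]
        exact (K t s).le_of_opNorm_le_of_le le_rfl (hw_le k s)
      rw [integral_add ((hKint t ht).mul_const c) hmint, integral_mul_const] at h1
      have h2 := mul_le_mul_of_nonneg_right (hKlam t ht) hc0
      have h3 : ‖w k t‖ ≤ ‖r k t‖ + ‖∫ s in Ioi t, K t s (w k s)‖ := by
        rw [hw k t ht]; exact norm_sub_le _ _
      have h4 : 0 ≤ ∫ s in Ioi t, ‖K t s‖ * m k s :=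
        integral_nonneg fun s => mul_nonneg (norm_nonneg _) (hm0 k s)
      have h5 : lam ^ (N + 1) * C = lam * c := by rw [hc]; ring
      refine max_le ?_ (add_nonneg (norm_nonneg _) h4)
      rw [h5]
      linarith
  rw [tendsto_zero_iff_norm_tendsto_zero, Metric.tendsto_atTop]
  intro η hη
  have hpow : Tendsto (fun N : ℕ => lam ^ N * C) atTop (𝓝 0) := by
    simpa using (tendsto_pow_atTop_nhds_zero_of_lt_one hlam0 hlam).mul_const C
  obtain ⟨N, hN⟩ := (hpow.eventually (gt_mem_nhds (half_pos hη))).exists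
  obtain ⟨k₀, hk₀⟩ := eventually_atTop.1
    ((improve N t ht).eventually (gt_mem_nhds (half_pos hη)))
  refine ⟨k₀, fun k hk => ?_⟩
  have := hk₀ k hk
  rw [Real.dist_eq, sub_zero, abs_of_nonneg (norm_nonneg _)]
  linarith [le_max_left (‖w k t‖ - lam ^ N * C) 0]

/-- Splitting of the difference of two Volterra integrals. -/
lemma integral_kernel_sub {t C₁ C₂ : ℝ} {G : ℝ → ℝ} {K L : ℝ → E →L[ℂ] E} {φ ψ : ℝ → E}
    (hG : IntegrableOn G (Ioi t)) (hK : ContinuousOn K (Ioi t)) (hL : ContinuousOn L (Ioi t))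
    (hKG : ∀ s, t ≤ s → ‖K s‖ ≤ G s) (hLG : ∀ s, t ≤ s → ‖L s‖ ≤ G s)
    (hφ : ContinuousOn φ (Ioi t)) (hψ : ContinuousOn ψ (Ioi t))
    (hφC : ∀ s, t ≤ s → ‖φ s‖ ≤ C₁) (hψC : ∀ s, t ≤ s → ‖ψ s‖ ≤ C₂) :
    (∫ s in Ioi t, K s (φ s)) - ∫ s in Ioi t, L s (ψ s) =
      (∫ s in Ioi t, (K s - L s) (φ s)) + ∫ s in Ioi t, L s (φ s - ψ s) := by
  have m {F : Type _} [NormedAddCommGroup F] {f : ℝ → F} (hf : ContinuousOn f (Ioi t)) :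
      AEStronglyMeasurable f (volume.restrict (Ioi t)) :=
    hf.aestronglyMeasurable measurableSet_Ioi
  have h1 := integrableOn_kernel_apply_s11 hG (m hK) (m hφ) hKG hφC
  have h2 := integrableOn_kernel_apply_s11 hG (m hL) (m hφ) hLG hφC
  have h3 := integrableOn_kernel_apply_s11 hG (m hL) (m hψ) hLG hψC
  simp_rw [map_sub, sub_apply]
  rw [integral_sub h1 h2, integral_sub h2 h3]
  abel

/-- Bounded solutions of a Volterra equation at infinity depend Lipschitz continuously on a
parameter, uniformly in `t`, when the data do so with integrable Lipschitz constant. -/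
lemma exists_lipschitz_solution_volterra {T lam Ma δ ε : ℝ} {G : ℝ → ℝ}
    {K : ℝ → ℝ → ℝ → E →L[ℂ] E} {a x : ℝ → ℝ → E} (hδ : 0 < δ)
    (hK : ∀ e ∈ Metric.ball ε δ, ContinuousOn (fun p : ℝ × ℝ => K p.1 p.2 e)
      {p : ℝ × ℝ | T ≤ p.1 ∧ p.1 ≤ p.2})
    (hG : IntegrableOn G (Ici T))
    (hKG : ∀ t s, T ≤ t → t ≤ s → ∀ e ∈ Metric.ball ε δ, ‖K t s e‖ ≤ G s)
    (hKL : ∀ t s, T ≤ t → t ≤ s → ∀ e ∈ Metric.ball ε δ, ‖K t s e - K t s ε‖ ≤ G s * |e - ε|)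
    (hKint : ∀ t, T ≤ t → IntegrableOn (fun s => ‖K t s ε‖) (Ioi t))
    (hlam : lam < 1) (hKlam : ∀ t, T ≤ t → ∫ s in Ioi t, ‖K t s ε‖ ≤ lam)
    (haL : ∀ t ∈ Ici T, ∀ e ∈ Metric.ball ε δ, ‖a t e - a t ε‖ ≤ Ma * |e - ε|)
    (hx_bdd : ∀ e ∈ Metric.ball ε δ, ∃ M : ℝ, ∀ t ∈ Ici T, ‖x t e‖ ≤ M)
    (hx_cont : ∀ e ∈ Metric.ball ε δ, ContinuousOn (fun t => x t e) (Ici T))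
    (hx : ∀ e ∈ Metric.ball ε δ, ∀ t ∈ Ici T,
      x t e = a t e - ∫ s in Ioi t, K t s e (x s e)) :
    ∃ C : ℝ, ∃ δ' > 0, δ' ≤ δ ∧ ∀ e ∈ Metric.ball ε δ', ∀ t ∈ Ici T,
      ‖x t e - x t ε‖ ≤ C * |e - ε| := by
  have hε : ε ∈ Metric.ball ε δ := Metric.mem_ball_self hδ
  have hKr : ∀ e ∈ Metric.ball ε δ, ∀ t, T ≤ t → ContinuousOn (fun s => K t s e) (Ioi t) :=
    fun e he t ht => continuousOn_kernel_right (K := fun t s => K t s e) (hK e he) ht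
  obtain ⟨M, hM⟩ := hx_bdd ε hε
  have hM0 : 0 ≤ M := (norm_nonneg _).trans (hM T self_mem_Ici)
  have hG0 : ∀ s ∈ Ici T, 0 ≤ G s := fun s hs =>
    (norm_nonneg _).trans (hKG T s le_rfl hs ε hε)
  have hMa0 : 0 ≤ Ma := by
    have h := haL T self_mem_Ici (ε + δ / 2) (by
      rw [Metric.mem_ball, Real.dist_eq, add_sub_cancel_left, abs_of_pos (by positivity)]
      linarith)
    rw [add_sub_cancel_left, abs_of_pos (by positivity)] at h
    exact nonneg_of_mul_nonneg_left ((norm_nonneg _).trans h) (by positivity)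
  set Γ := ∫ s in Ici T, G s with hΓ
  have hΓ0 : 0 ≤ Γ := setIntegral_nonneg measurableSet_Ici hG0
  have hGt : ∀ t, T ≤ t → IntegrableOn G (Ioi t) := fun t ht =>
    hG.mono_set (Ioi_subset_Ici_self.trans (Ici_subset_Ici.2 ht))
  have hΓt : ∀ t, T ≤ t → ∫ s in Ioi t, G s ≤ Γ := fun t ht =>
    setIntegral_mono_set hG ((ae_restrict_mem measurableSet_Ici).mono hG0)
      (Ioi_subset_Ici_self.trans (Ici_subset_Ici.2 ht)).eventuallyLE
  refine ⟨2 * (Ma + Γ * M) / (1 - lam), min δ ((1 - lam) / (2 * (Γ + 1))),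
    lt_min hδ (div_pos (by linarith) (by positivity)), min_le_left _ _, fun e he t ht => ?_⟩
  have heδ : e ∈ Metric.ball ε δ := Metric.ball_subset_ball (min_le_left _ _) he
  have hsmall : |e - ε| * (2 * (Γ + 1)) < 1 - lam := by
    rw [Metric.mem_ball, Real.dist_eq] at he
    exact (lt_div_iff₀ (by positivity)).1 (he.trans_le (min_le_right _ _))
  have hh := abs_nonneg (e - ε)
  obtain ⟨Me, hMe⟩ := hx_bdd e heδ
  have hq : |e - ε| * Γ + lam ≤ (1 + lam) / 2 := by nlinarith
  have hmain := norm_le_div_of_self_bound (ι := Ici T) (f := fun t => x t e - x t ε)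
    (M := Me + M) (p := |e - ε| * (Ma + Γ * M)) (q := |e - ε| * Γ + lam) (by linarith)
    (fun t => (norm_sub_le _ _).trans (add_le_add (hMe t t.2) (hM t t.2))) ?_ ⟨t, ht⟩
  · refine hmain.trans ?_
    rw [div_mul_eq_mul_div, div_le_div_iff₀ (by linarith) (by linarith)]
    have hp : 0 ≤ |e - ε| * (Ma + Γ * M) := by positivity
    nlinarith
  intro D hD t
  have ht := t.2
  have hD0 : 0 ≤ D := (norm_nonneg _).trans (hD t)
  have hDs : ∀ s, (t : ℝ) ≤ s → ‖x s e - x s ε‖ ≤ D := fun s hs => hD ⟨s, le_trans ht hs⟩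
  have hsub : Ioi (t : ℝ) ⊆ Ici T := Ioi_subset_Ici_self.trans (Ici_subset_Ici.2 ht)
  have hsplit := integral_kernel_sub (K := fun s => K t s e) (L := fun s => K t s ε)
    (φ := fun s => x s e) (ψ := fun s => x s ε) (hGt t ht) (hKr e heδ t ht)
    (hKr ε hε t ht) (fun s hs => hKG t s ht hs e heδ)
    (fun s hs => hKG t s ht hs ε hε) ((hx_cont e heδ).mono hsub) ((hx_cont ε hε).mono hsub)
    (fun s hs => hMe s (le_trans ht hs)) (fun s hs => hM s (le_trans ht hs))
  have h1 : ‖∫ s in Ioi (t : ℝ), (K t s e - K t s ε) (x s e)‖ ≤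
      ∫ s in Ioi (t : ℝ), G s * (|e - ε| * (M + D)) := by
    refine norm_integral_le_of_norm_le ((hGt t ht).mul_const _) ?_
    filter_upwards [ae_restrict_mem measurableSet_Ioi] with s hs
    rw [← mul_assoc]
    refine ContinuousLinearMap.le_of_opNorm_le_of_le _ (hKL t s ht (le_of_lt hs) e heδ) ?_
    have := norm_le_norm_add_norm_sub' (x s e) (x s ε)
    linarith [hM s (hsub hs), hDs s (le_of_lt hs)]
  rw [integral_mul_const] at h1
  have h2 := norm_integral_kernel_le hD0 (hKint t ht) (hKlam t ht) hDs
  have h3 : x t e - x t ε = (a t e - a t ε) - (∫ s in Ioi (t : ℝ), (K t s e - K t s ε) (x s e))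
      - ∫ s in Ioi (t : ℝ), K t s ε (x s e - x s ε) := by
    rw [sub_sub, ← hsplit, hx e heδ t ht, hx ε hε t ht]
    abel
  have h4 : (∫ s in Ioi (t : ℝ), G s) * (|e - ε| * (M + D)) ≤ Γ * (|e - ε| * (M + D)) :=
    mul_le_mul_of_nonneg_right (hΓt t ht) (by positivity)
  have h5 := haL t ht e heδ
  change ‖x t e - x t ε‖ ≤ _
  rw [h3]
  refine (norm_sub_le _ _).trans ?_
  have h6 := norm_sub_le (a t e - a t ε) (∫ s in Ioi (t : ℝ), (K t s e - K t s ε) (x s e))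
  nlinarith

/-- The parameter derivative of a family of kernels is measurable. -/
lemma aestronglyMeasurable_kernel_deriv {δ ε t : ℝ} {K : ℝ → ℝ → E →L[ℂ] E}
    {D : ℝ → E →L[ℂ] E} (hδ : 0 < δ)
    (hK : ∀ e ∈ Metric.ball ε δ, ContinuousOn (fun s => K s e) (Ioi t))
    (hD : ∀ s, t ≤ s → HasDerivAt (K s) (D s) ε) :
    AEStronglyMeasurable D (volume.restrict (Ioi t)) := by
  classical
  have hε : ε ∈ Metric.ball ε δ := Metric.mem_ball_self hδ
  refine aestronglyMeasurable_of_tendsto_ae (𝓝[≠] ε)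
    (f := fun e s => if e ∈ Metric.ball ε δ then slope (K s) ε e else 0) (fun e => ?_) ?_
  · by_cases he : e ∈ Metric.ball ε δ
    · simp only [he, if_true, slope_def_module]
      exact (((hK e he).sub (hK ε hε)).const_smul (e - ε)⁻¹).aestronglyMeasurable measurableSet_Ioi
    · simp only [he, if_false]
      exact aestronglyMeasurable_const
  · filter_upwards [ae_restrict_mem measurableSet_Ioi] with s hs
    refine (hasDerivAt_iff_tendsto_slope.1 (hD s (le_of_lt hs))).congr' ?_
    filter_upwards [mem_nhdsWithin_of_mem_nhds (Metric.ball_mem_nhds ε hδ)] with e he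
    rw [if_pos he]

/-- Differentiable dependence on a parameter of bounded solutions of a Volterra equation at
infinity: a bounded solution of the formally differentiated equation is the derivative. -/
lemma hasDerivAt_solution_volterra {T lam Ma δ ε : ℝ} {G : ℝ → ℝ}
    {K : ℝ → ℝ → ℝ → E →L[ℂ] E} {D : ℝ → ℝ → E →L[ℂ] E} {a x : ℝ → ℝ → E} {a' y : ℝ → E}
    (hδ : 0 < δ)
    (hK : ∀ e ∈ Metric.ball ε δ, ContinuousOn (fun p : ℝ × ℝ => K p.1 p.2 e)
      {p : ℝ × ℝ | T ≤ p.1 ∧ p.1 ≤ p.2})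
    (hG : IntegrableOn G (Ici T))
    (hKG : ∀ t s, T ≤ t → t ≤ s → ∀ e ∈ Metric.ball ε δ, ‖K t s e‖ ≤ G s)
    (hKL : ∀ t s, T ≤ t → t ≤ s → ∀ e ∈ Metric.ball ε δ, ‖K t s e - K t s ε‖ ≤ G s * |e - ε|)
    (hKD : ∀ t s, T ≤ t → t ≤ s → HasDerivAt (K t s) (D t s) ε)
    (hKint : ∀ t, T ≤ t → IntegrableOn (fun s => ‖K t s ε‖) (Ioi t))
    (hlam : lam < 1) (hKlam : ∀ t, T ≤ t → ∫ s in Ioi t, ‖K t s ε‖ ≤ lam)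
    (haL : ∀ t ∈ Ici T, ∀ e ∈ Metric.ball ε δ, ‖a t e - a t ε‖ ≤ Ma * |e - ε|)
    (haD : ∀ t ∈ Ici T, HasDerivAt (a t) (a' t) ε)
    (hx_bdd : ∀ e ∈ Metric.ball ε δ, ∃ M : ℝ, ∀ t ∈ Ici T, ‖x t e‖ ≤ M)
    (hx_cont : ∀ e ∈ Metric.ball ε δ, ContinuousOn (fun t => x t e) (Ici T))
    (hx : ∀ e ∈ Metric.ball ε δ, ∀ t ∈ Ici T,
      x t e = a t e - ∫ s in Ioi t, K t s e (x s e))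
    (hy_bdd : ∃ M : ℝ, ∀ t ∈ Ici T, ‖y t‖ ≤ M) (hy_cont : ContinuousOn y (Ici T))
    (hy : ∀ t ∈ Ici T, y t = (a' t - ∫ s in Ioi t, D t s (x s ε))
      - ∫ s in Ioi t, K t s ε (y s)) (t : ℝ) (ht : t ∈ Ici T) :
    HasDerivAt (x t) (y t) ε := by
  have hε : ε ∈ Metric.ball ε δ := Metric.mem_ball_self hδ
  have hKr : ∀ e ∈ Metric.ball ε δ, ∀ t, T ≤ t → ContinuousOn (fun s => K t s e) (Ioi t) :=
    fun e he t ht => continuousOn_kernel_right (K := fun t s => K t s e) (hK e he) ht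
  obtain ⟨C, δ', hδ', hδ'δ, hC⟩ := exists_lipschitz_solution_volterra hδ hK hG hKG hKL hKint hlam
    hKlam haL hx_bdd hx_cont hx
  obtain ⟨M, hM⟩ := hx_bdd ε hε
  obtain ⟨My, hMy⟩ := hy_bdd
  have hGt : ∀ t, T ≤ t → IntegrableOn G (Ioi t) := fun t ht =>
    hG.mono_set (Ioi_subset_Ici_self.trans (Ici_subset_Ici.2 ht))
  rw [hasDerivAt_iff_tendsto_slope]
  refine tendsto_of_seq_tendsto fun u hu => ?_
  have hu' := tendsto_nhdsWithin_iff.1 hu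
  obtain ⟨N, hN⟩ := eventually_atTop.1
    ((hu'.1.eventually (Metric.ball_mem_nhds ε hδ')).and hu'.2)
  rw [← tendsto_add_atTop_iff_nat N, tendsto_iff_norm_sub_tendsto_zero,
    ← tendsto_zero_iff_norm_tendsto_zero]
  set v : ℕ → ℝ := fun k => u (k + N) with hv
  have hvball' : ∀ k, v k ∈ Metric.ball ε δ' := fun k => (hN (k + N) (by omega)).1
  have hvball : ∀ k, v k ∈ Metric.ball ε δ := fun k =>
    Metric.ball_subset_ball hδ'δ (hvball' k)
  have hvne : ∀ k, v k ≠ ε := fun k => (hN (k + N) (by omega)).2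
  have hvpos : ∀ k, 0 < |v k - ε| := fun k => abs_pos.2 (sub_ne_zero.2 (hvne k))
  have hvlim : Tendsto v atTop (𝓝[≠] ε) := (tendsto_add_atTop_iff_nat N).2 hu
  have hslope {F : Type _} [NormedAddCommGroup F] [NormedSpace ℝ F] {f : ℝ → F} {c : ℝ} {k : ℕ}
      (h : ‖f (v k) - f ε‖ ≤ c * |v k - ε|) : ‖slope f ε (v k)‖ ≤ c := by
    rw [slope_def_module, norm_smul, norm_inv, Real.norm_eq_abs, inv_mul_le_iff₀ (hvpos k),
      mul_comm]
    exact h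
  have hslope_x : ∀ k, ∀ s ∈ Ici T, ‖slope (x s) ε (v k)‖ ≤ C := fun k s hs =>
    hslope (hC (v k) (hvball' k) s hs)
  have hslope_K : ∀ k t s, T ≤ t → t ≤ s → ‖slope (K t s) ε (v k)‖ ≤ G s :=
    fun k t s ht hs => hslope (hKL t s ht hs (v k) (hvball k))
  have hslope_x_cont : ∀ k, ContinuousOn (fun s => slope (x s) ε (v k)) (Ici T) := by
    intro k
    simp only [slope_def_module]
    exact ((hx_cont _ (hvball k)).sub (hx_cont ε hε)).const_smul (v k - ε)⁻¹
  have hslope_K_cont : ∀ k t, T ≤ t → ContinuousOn (fun s => slope (K t s) ε (v k)) (Ioi t) := by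
    intro k t ht
    simp only [slope_def_module]
    exact ((hKr _ (hvball k) t ht).sub
      (hKr ε hε t ht)).const_smul (v k - ε)⁻¹
  have hxv_bdd : ∀ k, ∀ s ∈ Ici T, ‖x s (v k)‖ ≤ M + C * δ' := by
    intro k s hs
    have h1 := hC (v k) (hvball' k) s hs
    have h2 := norm_le_norm_add_norm_sub' (x s (v k)) (x s ε)
    have h3 : |v k - ε| ≤ δ' := le_of_lt (by simpa [Real.dist_eq] using hvball' k)
    have h4 : 0 ≤ C := (norm_nonneg _).trans (hslope_x k s hs)
    nlinarith [hM s hs]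
  have hsub : ∀ t, T ≤ t → Ioi t ⊆ Ici T := fun t ht =>
    Ioi_subset_Ici_self.trans (Ici_subset_Ici.2 ht)
  have hx_tendsto : ∀ s ∈ Ici T, Tendsto (fun k => x s (v k)) atTop (𝓝 (x s ε)) := by
    intro s hs
    rw [tendsto_iff_norm_sub_tendsto_zero]
    have : Tendsto (fun k => C * |v k - ε|) atTop (𝓝 0) := by
      have h := (tendsto_nhds_of_tendsto_nhdsWithin hvlim).sub_const ε
      rw [sub_self] at h
      simpa using h.abs.const_mul C
    exact squeeze_zero (fun _ => norm_nonneg _) (fun k => hC _ (hvball' k) s hs) this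
  refine tendsto_zero_of_volterra (T := T) (lam := lam) (C := C + My)
    (K := fun t s => K t s ε) (w := fun k t => slope (x t) ε (v k) - y t)
    (r := fun k t => (slope (a t) ε (v k) - a' t) -
      ((∫ s in Ioi t, slope (K t s) ε (v k) (x s (v k))) - ∫ s in Ioi t, D t s (x s ε)))
    hKint hlam hKlam (fun k => (hslope_x_cont k).sub hy_cont)
    (fun k t ht => (norm_sub_le _ _).trans (add_le_add (hslope_x k t ht) (hMy t ht))) ?_ ?_ t ht
  · intro k t ht
    have hsplit := integral_kernel_sub (K := fun s => K t s (v k)) (L := fun s => K t s ε)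
      (φ := fun s => x s (v k)) (ψ := fun s => x s ε) (hGt t ht)
      (hKr _ (hvball k) t ht)
      (hKr ε hε t ht) (fun s hs => hKG t s ht hs _ (hvball k))
      (fun s hs => hKG t s ht hs ε hε) ((hx_cont _ (hvball k)).mono (hsub t ht))
      ((hx_cont ε hε).mono (hsub t ht))
      (fun s hs => hxv_bdd k s (le_trans (mem_Ici.1 ht) hs))
      (fun s hs => hM s (le_trans (mem_Ici.1 ht) hs))
    have hKm : AEStronglyMeasurable (fun s => K t s ε) (volume.restrict (Ioi t)) :=
      (hKr ε hε t ht).aestronglyMeasurable measurableSet_Ioi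
    have hi1 := integrableOn_kernel_apply_s11 (φ := fun s => slope (x s) ε (v k)) (hGt t ht) hKm
      (((hslope_x_cont k).mono (hsub t ht)).aestronglyMeasurable measurableSet_Ioi)
      (fun s hs => hKG t s ht hs ε hε)
      (fun s hs => hslope_x k s (le_trans (mem_Ici.1 ht) hs))
    have hi2 := integrableOn_kernel_apply_s11 (hGt t ht) hKm
      ((hy_cont.mono (hsub t ht)).aestronglyMeasurable measurableSet_Ioi)
      (fun s hs => hKG t s ht hs ε hε)
      (fun s hs => hMy s (le_trans (mem_Ici.1 ht) hs))
    have h1 : ∫ s in Ioi t, K t s ε (slope (x s) ε (v k) - y s) =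
        (∫ s in Ioi t, K t s ε (slope (x s) ε (v k))) - ∫ s in Ioi t, K t s ε (y s) := by
      simp_rw [map_sub]
      exact integral_sub hi1 hi2
    have h2 : slope (x t) ε (v k) = slope (a t) ε (v k)
        - (∫ s in Ioi t, slope (K t s) ε (v k) (x s (v k)))
        - ∫ s in Ioi t, K t s ε (slope (x s) ε (v k)) := by
      have h3 : (∫ s in Ioi t, slope (K t s) ε (v k) (x s (v k))) =
          (v k - ε)⁻¹ • ∫ s in Ioi t, (K t s (v k) - K t s ε) (x s (v k)) := by
        rw [← integral_smul]
        simp only [slope_def_module, smul_apply]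
      have h4 : (∫ s in Ioi t, K t s ε (slope (x s) ε (v k))) =
          (v k - ε)⁻¹ • ∫ s in Ioi t, K t s ε (x s (v k) - x s ε) := by
        rw [← integral_smul]
        simp_rw [slope_def_module, fun s (c : ℝ) v => (K t s ε).map_smul_of_tower c v]
      rw [h3, h4, sub_sub, ← smul_add, ← hsplit]
      simp only [slope_def_module]
      rw [← smul_sub, hx _ (hvball k) t ht, hx ε hε t ht]
      congr 1
      abel
    rw [h1]
    nth_rewrite 1 [h2]
    nth_rewrite 1 [hy t ht]
    abel
  · intro t ht
    have hlim : Tendsto (fun k => ∫ s in Ioi t, slope (K t s) ε (v k) (x s (v k))) atTop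
        (𝓝 (∫ s in Ioi t, D t s (x s ε))) := by
      refine tendsto_integral_of_dominated_convergence (fun s => G s * (M + C * δ')) ?_
        ((hGt t ht).mul_const _) ?_ ?_
      · intro k
        exact ((hslope_K_cont k t ht).clm_apply
          ((hx_cont _ (hvball k)).mono (hsub t ht))).aestronglyMeasurable measurableSet_Ioi
      · intro k
        filter_upwards [ae_restrict_mem measurableSet_Ioi] with s hs
        exact ContinuousLinearMap.le_of_opNorm_le_of_le _ (hslope_K k t s ht (le_of_lt hs))
          (hxv_bdd k s (hsub t ht hs))
      · filter_upwards [ae_restrict_mem measurableSet_Ioi] with s hs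
        have hDs := (hasDerivAt_iff_tendsto_slope.1 (hKD t s ht (le_of_lt hs))).comp hvlim
        exact (isBoundedBilinearMap_apply (𝕜 := ℂ).continuous.tendsto (D t s, x s ε)).comp
          (hDs.prodMk_nhds (hx_tendsto s (hsub t ht hs)))
    have ha := ((hasDerivAt_iff_tendsto_slope.1 (haD t ht)).comp hvlim).sub_const (a' t)
    have := ha.sub (hlim.sub_const (∫ s in Ioi t, D t s (x s ε)))
    simpa using this

/-- A function with Lipschitz derivative is approximated by its difference quotients at a linear
rate. -/
lemma norm_slope_sub_deriv_le {F : Type*} [NormedAddCommGroup F] [NormedSpace ℝ F]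
    {f f' : ℝ → F} {C δ ε e : ℝ} (hf : ∀ e ∈ Metric.ball ε δ, HasDerivAt f (f' e) e)
    (hf' : ∀ e ∈ Metric.ball ε δ, ‖f' e - f' ε‖ ≤ C * |e - ε|)
    (he : e ∈ Metric.ball ε δ) (hne : e ≠ ε) :
    ‖slope f ε e - f' ε‖ ≤ C * |e - ε| := by
  have hsub : Metric.closedBall ε |e - ε| ⊆ Metric.ball ε δ :=
    Metric.closedBall_subset_ball (by simpa [Real.dist_eq] using he)
  have hpos : 0 < |e - ε| := abs_pos.2 (sub_ne_zero.2 hne)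
  have hC : 0 ≤ C := nonneg_of_mul_nonneg_left ((norm_nonneg _).trans (hf' e he)) hpos
  have h := (convex_closedBall ε |e - ε|).norm_image_sub_le_of_norm_hasDerivWithin_le
    (f := fun z => f z - z • f' ε) (f' := fun z => f' z - f' ε) (C := C * |e - ε|) (x := ε) (y := e)
    (fun z hz => by
      have h := ((hasDerivAt_id z).smul_const (f' ε)).hasDerivWithinAt
        (s := Metric.closedBall ε |e - ε|)
      rw [one_smul] at h
      exact (hf z (hsub hz)).hasDerivWithinAt.sub h)
    (fun z hz => (hf' z (hsub hz)).trans (mul_le_mul_of_nonneg_left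
      (by simpa [Real.dist_eq] using hz) hC))
    (Metric.mem_closedBall_self (abs_nonneg _)) (by simp [Real.dist_eq])
  have h2 : slope f ε e - f' ε = (e - ε)⁻¹ • ((f e - e • f' ε) - (f ε - ε • f' ε)) := by
    have h3 : (f e - e • f' ε) - (f ε - ε • f' ε) = (f e - f ε) - (e - ε) • f' ε := by
      rw [sub_smul]; abel
    rw [h3, smul_sub, inv_smul_smul₀ (sub_ne_zero.2 hne), slope_def_module]
  rw [h2, norm_smul, norm_inv, Real.norm_eq_abs, inv_mul_le_iff₀ hpos, mul_comm]
  exact h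

/-- The parameter derivative of a product is continuous in a further variable, when the product is
and the first factor is differentiable uniformly in that variable. -/
lemma continuousOn_deriv_mul {X R : Type*} [TopologicalSpace X] [NormedRing R] [NormedAlgebra ℝ R]
    {S : Set X} {f : X → ℝ → R} {f' : X → R} {g : ℝ → R} {g' : R} {C δ ε : ℝ} (hδ : 0 < δ)
    (hf : ∀ x ∈ S, ∀ e ∈ Metric.ball ε δ, e ≠ ε → ‖slope (f x) ε e - f' x‖ ≤ C * |e - ε|)
    (hfC : ∀ x ∈ S, ‖f x ε‖ ≤ C) (hf'C : ∀ x ∈ S, ‖f' x‖ ≤ C) (hg : HasDerivAt g g' ε)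
    (hc : ∀ e ∈ Metric.ball ε δ, ContinuousOn (fun x => f x e * g e) S) :
    ContinuousOn (fun x => f' x * g ε + f x ε * g') S := by
  have hβ : Tendsto (fun e => C * |e - ε| * ‖g e‖ + C * ‖g e - g ε‖ + C * ‖slope g ε e - g'‖)
      (𝓝[≠] ε) (𝓝 0) := by
    have h1 : Tendsto (fun e => |e - ε|) (𝓝[≠] ε) (𝓝 0) := by
      have : Continuous fun e : ℝ => |e - ε| := by fun_prop
      simpa using (this.tendsto ε).mono_left nhdsWithin_le_nhds
    have h2 : Tendsto g (𝓝[≠] ε) (𝓝 (g ε)) := hg.continuousAt.tendsto.mono_left nhdsWithin_le_nhds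
    have h3 := (hasDerivAt_iff_tendsto_slope.1 hg).sub_const g'
    simpa using (((h1.const_mul C).mul h2.norm).add ((h2.sub_const (g ε)).norm.const_mul C)).add
      (h3.norm.const_mul C)
  have hball : ∀ᶠ e in 𝓝[≠] ε, e ∈ Metric.ball ε δ :=
    mem_nhdsWithin_of_mem_nhds (Metric.ball_mem_nhds ε hδ)
  refine TendstoUniformlyOn.continuousOn (p := 𝓝[≠] ε)
    (F := fun e x => slope (fun z => f x z * g z) ε e) ?_ ?_
  · rw [Metric.tendstoUniformlyOn_iff]
    intro η hη
    filter_upwards [hβ.eventually (gt_mem_nhds hη), hball, self_mem_nhdsWithin] with e h1 he hne x hx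
    refine lt_of_le_of_lt ?_ h1
    have hid : slope (fun z => f x z * g z) ε e - (f' x * g ε + f x ε * g') =
        (slope (f x) ε e - f' x) * g e + f' x * (g e - g ε) + f x ε * (slope g ε e - g') := by
      have : slope (fun z => f x z * g z) ε e = slope (f x) ε e * g e + f x ε * slope g ε e := by
        simp only [slope_def_module, smul_mul_assoc, mul_smul_comm, ← smul_add]
        congr 1
        noncomm_ring
      rw [this]
      noncomm_ring
    rw [dist_comm, dist_eq_norm, hid]
    refine (norm_add₃_le).trans (add_le_add (add_le_add ?_ ?_) ?_)
    · exact (norm_mul_le _ _).trans (mul_le_mul_of_nonneg_right (hf x hx e he hne) (norm_nonneg _))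
    · exact (norm_mul_le _ _).trans (mul_le_mul_of_nonneg_right (hf'C x hx) (norm_nonneg _))
    · exact (norm_mul_le _ _).trans (mul_le_mul_of_nonneg_right (hfC x hx) (norm_nonneg _))
  · refine Eventually.frequently ?_
    filter_upwards [hball] with e he
    simp only [slope_def_module]
    exact ((hc e he).sub (hc ε (Metric.mem_ball_self hδ))).const_smul _

/-- Mean value inequality on a ball, centred form. -/
lemma norm_sub_center_le_of_hasDerivAt {F : Type*} [NormedAddCommGroup F] [NormedSpace ℝ F]
    {f f' : ℝ → F} {C δ ε e : ℝ} (hf : ∀ e ∈ Metric.ball ε δ, HasDerivAt f (f' e) e)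
    (hf' : ∀ e ∈ Metric.ball ε δ, ‖f' e‖ ≤ C) (he : e ∈ Metric.ball ε δ) :
    ‖f e - f ε‖ ≤ C * |e - ε| :=
  (convex_ball ε δ).norm_image_sub_le_of_norm_hasDerivWithin_le
    (fun z hz => (hf z hz).hasDerivWithinAt) hf'
    (Metric.mem_ball_self (Metric.pos_of_mem_ball he)) he

end VolterraAtInfinity

/-- Differentiable dependence, Theorem 5.12 of the paper. For data
`(a(·,ε), K_ε)` of the Volterra integral equation at infinity, where `a`, `∂_ε a`,
`∂²_ε a` exist, are continuous in `t` and uniformly bounded, and the kernel is of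
product type `K(t,s,ε) = A(t,s,ε)·B(s,ε)` of order `(2,1)` with `λ(K_ε) < 1`, the
bounded solution `x(·,ε)` is differentiable in `ε`; its partial derivative
`∂_ε x` is bounded and continuous in `t` and solves the differentiated Volterra
equation. -/
theorem volterra_at_infinity_differentiable_dependence
    (T : ℝ) (n : ℕ) (hn : 1 ≤ n) (U : Set ℝ) (hU : IsOpen U)
    -- the inhomogeneity `a` and its first two `ε`-derivatives
    (a a' a'' : ℝ → ℝ → EuclideanSpace ℂ (Fin n))
    (ha_cont : ∀ ε ∈ U, ContinuousOn (fun t => a t ε) (Ici T))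
    (ha'_cont : ∀ ε ∈ U, ContinuousOn (fun t => a' t ε) (Ici T))
    (ha''_cont : ∀ ε ∈ U, ContinuousOn (fun t => a'' t ε) (Ici T))
    (ha_deriv : ∀ t ∈ Ici T, ∀ ε ∈ U, HasDerivWithinAt (fun e => a t e) (a' t ε) U ε)
    (ha'_deriv : ∀ t ∈ Ici T, ∀ ε ∈ U, HasDerivWithinAt (fun e => a' t e) (a'' t ε) U ε)
    (Ma : ℝ) (ha_bdd : ∀ t ∈ Ici T, ∀ ε ∈ U, ‖a t ε‖ ≤ Ma ∧ ‖a' t ε‖ ≤ Ma ∧ ‖a'' t ε‖ ≤ Ma)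
    -- the kernel, of product type `K(t,s,ε) = A(t,s,ε)·B(s,ε)`
    (A A' A'' : ℝ → ℝ → ℝ → EuclideanSpace ℂ (Fin n) →L[ℂ] EuclideanSpace ℂ (Fin n))
    (B B' : ℝ → ℝ → EuclideanSpace ℂ (Fin n) →L[ℂ] EuclideanSpace ℂ (Fin n))
    (hK_cont : ∀ ε ∈ U, ContinuousOn
      (fun p : ℝ × ℝ => (A p.1 p.2 ε).comp (B p.2 ε)) {p : ℝ × ℝ | T ≤ p.1 ∧ p.1 ≤ p.2})
    (hK_int : ∀ ε ∈ U, ∀ t ∈ Ici T,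
      IntegrableOn (fun s => ‖(A t s ε).comp (B s ε)‖) (Ioi t))
    (lam : ℝ → ℝ) (hlam : ∀ ε ∈ U, lam ε < 1)
    (hK_lam : ∀ ε ∈ U, ∀ t ∈ Ici T, (∫ s in Ioi t, ‖(A t s ε).comp (B s ε)‖) ≤ lam ε)
    (hA_deriv : ∀ t s : ℝ, T ≤ t → t ≤ s → ∀ ε ∈ U,
      HasDerivWithinAt (fun e => A t s e) (A' t s ε) U ε)
    (hA'_deriv : ∀ t s : ℝ, T ≤ t → t ≤ s → ∀ ε ∈ U,
      HasDerivWithinAt (fun e => A' t s e) (A'' t s ε) U ε)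
    (CA : ℝ) (hA_bdd : ∀ t s : ℝ, T ≤ t → t ≤ s → ∀ ε ∈ U,
      ‖A t s ε‖ ≤ CA ∧ ‖A' t s ε‖ ≤ CA ∧ ‖A'' t s ε‖ ≤ CA)
    (hB_deriv : ∀ s ∈ Ici T, ∀ ε ∈ U, HasDerivWithinAt (fun e => B s e) (B' s ε) U ε)
    (hB_ib : IntegrallyBounded T U B) (hB'_ib : IntegrallyBounded T U B')
    -- the unique bounded solution for each parameter value
    (x : ℝ → ℝ → EuclideanSpace ℂ (Fin n))
    (hx_bdd : ∀ ε ∈ U, ∃ M : ℝ, ∀ t ∈ Ici T, ‖x t ε‖ ≤ M)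
    (hx_cont : ∀ ε ∈ U, ContinuousOn (fun t => x t ε) (Ici T))
    (hx_eq : ∀ ε ∈ U, ∀ t ∈ Ici T,
      x t ε = a t ε - ∫ s in Ioi t, (A t s ε).comp (B s ε) (x s ε)) :
    ∃ x₁ : ℝ → ℝ → EuclideanSpace ℂ (Fin n),
      (∀ t ∈ Ici T, ∀ ε ∈ U, HasDerivWithinAt (fun e => x t e) (x₁ t ε) U ε) ∧
      (∀ ε ∈ U, ContinuousOn (fun t => x₁ t ε) (Ici T)) ∧
      (∀ ε ∈ U, ∃ M : ℝ, ∀ t ∈ Ici T, ‖x₁ t ε‖ ≤ M) ∧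
      (∀ ε ∈ U, ∀ t ∈ Ici T,
        x₁ t ε = (a' t ε - ∫ s in Ioi t,
            ((A' t s ε).comp (B s ε) + (A t s ε).comp (B' s ε)) (x s ε))
          - ∫ s in Ioi t, (A t s ε).comp (B s ε) (x₁ s ε)) := by
  have key : ∀ ε ∈ U, ∃ y : ℝ → EuclideanSpace ℂ (Fin n),
      (∀ t ∈ Ici T, HasDerivAt (x t) (y t) ε) ∧ ContinuousOn y (Ici T) ∧
      (∃ M : ℝ, ∀ t ∈ Ici T, ‖y t‖ ≤ M) ∧
      ∀ t ∈ Ici T, y t = (a' t ε - ∫ s in Ioi t,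
          ((A' t s ε).comp (B s ε) + (A t s ε).comp (B' s ε)) (x s ε))
        - ∫ s in Ioi t, (A t s ε).comp (B s ε) (y s) := by
    intro ε hε
    obtain ⟨V, hV, hεV, hVU, g, hg0, -, hgint, hg⟩ := hB_ib ε hε
    obtain ⟨V', hV', hεV', -, g', hg0', -, hgint', hg'⟩ := hB'_ib ε hε
    obtain ⟨δ, hδ, hball⟩ := Metric.isOpen_iff.1 (hV.inter hV') ε ⟨hεV, hεV'⟩
    have hballU : Metric.ball ε δ ⊆ U := fun e he => hVU (hball he).1
    have hball_self : ε ∈ Metric.ball ε δ := Metric.mem_ball_self hδ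
    have hd {F : Type} [NormedAddCommGroup F] [NormedSpace ℝ F] {f : ℝ → F} {f' : ℝ → F}
        (h : ∀ e ∈ U, HasDerivWithinAt f (f' e) U e) :
        ∀ e ∈ Metric.ball ε δ, HasDerivAt f (f' e) e := fun e he =>
      (h e (hballU he)).hasDerivAt (hU.mem_nhds (hballU he))
    have hCA : 0 ≤ CA := (norm_nonneg _).trans (hA_bdd T T le_rfl le_rfl ε hε).1
    have hA_lip : ∀ t s, T ≤ t → t ≤ s → ∀ e ∈ Metric.ball ε δ,
        ‖A t s e - A t s ε‖ ≤ CA * |e - ε| := fun t s ht hs e he =>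
      norm_sub_center_le_of_hasDerivAt (hd (hA_deriv t s ht hs))
        (fun z hz => (hA_bdd t s ht hs z (hballU hz)).2.1) he
    have hA'_lip : ∀ t s, T ≤ t → t ≤ s → ∀ e ∈ Metric.ball ε δ,
        ‖A' t s e - A' t s ε‖ ≤ CA * |e - ε| := fun t s ht hs e he =>
      norm_sub_center_le_of_hasDerivAt (hd (hA'_deriv t s ht hs))
        (fun z hz => (hA_bdd t s ht hs z (hballU hz)).2.2) he
    have hB_lip : ∀ s, T ≤ s → ∀ e ∈ Metric.ball ε δ,
        ‖B s e - B s ε‖ ≤ g' s * |e - ε| := fun s hs e he =>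
      norm_sub_center_le_of_hasDerivAt (hd (hB_deriv s hs))
        (fun z hz => hg' z (hball hz).2 s hs) he
    have ha_lip : ∀ t ∈ Ici T, ∀ e ∈ Metric.ball ε δ,
        ‖a t e - a t ε‖ ≤ Ma * |e - ε| := fun t ht e he =>
      norm_sub_center_le_of_hasDerivAt (hd (ha_deriv t ht))
        (fun z hz => (ha_bdd t ht z (hballU hz)).2.1) he
    let K (t s e : ℝ) : EuclideanSpace ℂ (Fin n) →L[ℂ] EuclideanSpace ℂ (Fin n) :=
      (A t s e).comp (B s e)
    let D (t s : ℝ) : EuclideanSpace ℂ (Fin n) →L[ℂ] EuclideanSpace ℂ (Fin n) :=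
      (A' t s ε).comp (B s ε) + (A t s ε).comp (B' s ε)
    let G (s : ℝ) : ℝ := CA * (g s + g' s)
    have hG : IntegrableOn G (Ici T) := (hgint.add hgint').const_mul CA
    have hcomp {L₁ L₂ : EuclideanSpace ℂ (Fin n) →L[ℂ] EuclideanSpace ℂ (Fin n)} {c₁ c₂ : ℝ}
        (h₁ : ‖L₁‖ ≤ c₁) (h₂ : ‖L₂‖ ≤ c₂) : ‖L₁.comp L₂‖ ≤ c₁ * c₂ :=
      (L₁.opNorm_comp_le L₂).trans
        (mul_le_mul h₁ h₂ (norm_nonneg _) ((norm_nonneg _).trans h₁))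
    have hKG : ∀ t s, T ≤ t → t ≤ s → ∀ e ∈ Metric.ball ε δ, ‖K t s e‖ ≤ G s := by
      intro t s ht hs e he
      refine (hcomp (hA_bdd t s ht hs e (hballU he)).1
        (hg e (hball he).1 s (ht.trans hs))).trans ?_
      exact mul_le_mul_of_nonneg_left (by linarith [hg0' s (ht.trans hs)]) hCA
    have hKL : ∀ t s, T ≤ t → t ≤ s → ∀ e ∈ Metric.ball ε δ,
        ‖K t s e - K t s ε‖ ≤ G s * |e - ε| := by
      intro t s ht hs e he
      have h : K t s e - K t s ε =
          (A t s e - A t s ε).comp (B s e) + (A t s ε).comp (B s e - B s ε) := by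
        simp only [K, ContinuousLinearMap.sub_comp, ContinuousLinearMap.comp_sub]
        abel
      rw [h]
      refine (norm_add_le_of_le
        (hcomp (hA_lip t s ht hs e he) (hg e (hball he).1 s (ht.trans hs)))
        (hcomp (hA_bdd t s ht hs ε hε).1 (hB_lip s (ht.trans hs) e he))).trans (le_of_eq ?_)
      simp only [G]
      ring
    have hDG : ∀ t s, T ≤ t → t ≤ s → ‖D t s‖ ≤ G s := by
      intro t s ht hs
      refine (norm_add_le_of_le
        (hcomp (hA_bdd t s ht hs ε hε).2.1 (hg ε hεV s (ht.trans hs)))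
        (hcomp (hA_bdd t s ht hs ε hε).1 (hg' ε hεV' s (ht.trans hs)))).trans (le_of_eq ?_)
      simp only [G]
      ring
    have hKD : ∀ t s, T ≤ t → t ≤ s → HasDerivAt (K t s) (D t s) ε := fun t s ht hs =>
      (hd (hA_deriv t s ht hs) ε hball_self).mul (hd (hB_deriv s (ht.trans hs)) ε hball_self)
    have hK : ∀ e ∈ Metric.ball ε δ, ContinuousOn (fun p : ℝ × ℝ => K p.1 p.2 e)
        {p : ℝ × ℝ | T ≤ p.1 ∧ p.1 ≤ p.2} := fun e he => hK_cont e (hballU he)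
    have hD_cont : ∀ s, ContinuousOn (fun t => D t s) (Icc T s) := by
      intro s
      by_cases hs : T ≤ s
      · exact continuousOn_deriv_mul (f := fun t => A t s) (f' := fun t => A' t s ε)
          (g := B s) (C := CA) hδ
          (fun t ht e he hne => norm_slope_sub_deriv_le (hd (hA_deriv t s ht.1 ht.2))
            (hA'_lip t s ht.1 ht.2) he hne)
          (fun t ht => (hA_bdd t s ht.1 ht.2 ε hε).1)
          (fun t ht => (hA_bdd t s ht.1 ht.2 ε hε).2.1)
          (hd (hB_deriv s hs) ε hball_self)
          (fun e he => continuousOn_kernel_left (K := fun t s => K t s e) (hK e he))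
      · rw [Icc_eq_empty hs]
        exact continuousOn_empty _
    have hGt : ∀ t, T ≤ t → IntegrableOn G (Ioi t) := fun t ht =>
      hG.mono_set (Ioi_subset_Ici_self.trans (Ici_subset_Ici.2 ht))
    obtain ⟨M, hM⟩ := hx_bdd ε hε
    have hM0 : 0 ≤ M := (norm_nonneg _).trans (hM T self_mem_Ici)
    have hDm : ∀ t, T ≤ t → AEStronglyMeasurable (D t) (volume.restrict (Ioi t)) :=
      fun t ht => aestronglyMeasurable_kernel_deriv (K := fun s e => K t s e) hδ
        (fun e he => continuousOn_kernel_right (K := fun t s => K t s e) (hK e he) ht)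
        (fun s hs => hKD t s ht hs)
    have hDx_bdd : ∀ t s, T ≤ t → t ≤ s → ‖D t s (x s ε)‖ ≤ G s * M := fun t s ht hs =>
      (D t s).le_of_opNorm_le_of_le (hDG t s ht hs) (hM s (ht.trans hs))
    have hDx_cont : ContinuousOn (fun t => ∫ s in Ioi t, D t s (x s ε)) (Ici T) := by
      refine continuousOn_integral_Ioi (F := fun t s => D t s (x s ε)) (hG.mul_const M)
        (fun t ht => ?_) hDx_bdd (fun s => (hD_cont s).clm_apply continuousOn_const)
      exact (integrableOn_kernel_apply_s11 (hGt t ht) (hDm t ht)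
        (((hx_cont ε hε).mono (Ioi_subset_Ici_self.trans
          (Ici_subset_Ici.2 ht))).aestronglyMeasurable measurableSet_Ioi)
        (fun s hs => hDG t s ht hs) (fun s hs => hM s (ht.trans hs))).aestronglyMeasurable
    have hGM0 : ∀ s ∈ Ici T, 0 ≤ G s * M := fun s hs =>
      mul_nonneg (mul_nonneg hCA (add_nonneg (hg0 s hs) (hg0' s hs))) hM0
    have hDx_int : ∀ t ∈ Ici T, ‖∫ s in Ioi t, D t s (x s ε)‖ ≤ ∫ s in Ici T, G s * M := by
      intro t ht
      refine (norm_integral_le_of_norm_le ((hGt t ht).mul_const M) ?_).trans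
        (setIntegral_mono_set (hG.mul_const M) ((ae_restrict_mem measurableSet_Ici).mono hGM0)
          (Ioi_subset_Ici_self.trans (Ici_subset_Ici.2 ht)).eventuallyLE)
      filter_upwards [ae_restrict_mem measurableSet_Ioi] with s hs
      exact hDx_bdd t s ht (le_of_lt hs)
    obtain ⟨y, hy_cont, hy_bdd, hy⟩ := exists_bounded_solution_volterra
      (K := fun t s => K t s ε) (b := fun t => a' t ε - ∫ s in Ioi t, D t s (x s ε))
      (hK ε hball_self) hG (fun t s ht hs => hKG t s ht hs ε hball_self) (hK_int ε hε)
      (hlam ε hε) (hK_lam ε hε) ((ha'_cont ε hε).sub hDx_cont)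
      (fun t ht => norm_sub_le_of_le (ha_bdd t ht ε hε).2.1 (hDx_int t ht))
    refine ⟨y, ?_, hy_cont, hy_bdd, hy⟩
    exact hasDerivAt_solution_volterra (K := K) (D := D) (a' := fun t => a' t ε) hδ hK hG hKG hKL
      hKD (hK_int ε hε) (hlam ε hε) (hK_lam ε hε) ha_lip
      (fun t ht => hd (ha_deriv t ht) ε hball_self) (fun e he => hx_bdd e (hballU he))
      (fun e he => hx_cont e (hballU he)) (fun e he => hx_eq e (hballU he)) hy_bdd hy_cont hy
  choose! y hy_deriv hy_cont hy_bdd hy_eq using key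
  exact ⟨fun t ε => y ε t, fun t ht ε hε => (hy_deriv ε hε t ht).hasDerivWithinAt, hy_cont,
    hy_bdd, hy_eq⟩
end

section
/- Let T ∈ ℝ, n ≥ 1, and U ⊆ ℂ open. Let a : [T,∞) × U → ℂⁿ be bounded, continuous in t for each ε, and holomorphic in ε for each t. Let K : Δ(T) × U → Mₙ(ℂ) be continuous and of product type K(t,s,ε) = A(t,s,ε)·B(s,ε), where A and B are holomorphic in ε, ‖A‖ is bounded by a constant on Δ(T) × U, B is integrally bounded, and λ(K_ε) < 1 for every ε ∈ U. For each ε let x(·,ε) ∈ B_T be the unique bounded solution of the Volterra integral equation at infinity with data (a(·,ε), K_ε). Then for each t ∈ [T,∞) the map ε ↦ x(t, ε) is holomorphic on U, ∂_ε x(·,ε) is bounded, and ∂_ε x(t, ε) = (∂_ε a(t, ε) − ∫_t^∞ ∂_ε K(t,s,ε)·x(s,ε) ds) − ∫_t^∞ K(t,s,ε)·∂_ε x(s,ε) ds. -/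
open MeasureTheory Set

/-- A family `B : [T,∞) × U → Mₙ(ℂ)` (`U ⊆ ℂ`) is *integrally bounded* if every
`ε ∈ U` has an open neighborhood `V ⊆ U` and a bounded nonnegative function `g` on
`[T,∞)` with finite integral such that `‖B(s,μ)‖ ≤ g(s)` for all `μ ∈ V`, `s ≥ T`. -/
def IntegrallyBoundedC (T : ℝ) (U : Set ℂ) {F : Type*} [NormedAddCommGroup F]
    (B : ℝ → ℂ → F) : Prop :=
  ∀ ε ∈ U, ∃ V : Set ℂ, IsOpen V ∧ ε ∈ V ∧ V ⊆ U ∧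
    ∃ g : ℝ → ℝ, (∀ s ∈ Ici T, 0 ≤ g s) ∧ (∃ C : ℝ, ∀ s ∈ Ici T, g s ≤ C) ∧
      IntegrableOn g (Ici T) ∧ ∀ μ ∈ V, ∀ s ∈ Ici T, ‖B s μ‖ ≤ g s

open Metric Filter Topology

section Slope

theorem mapsTo_closedBall_of_norm_le {F : Type*} [NormedAddCommGroup F] {f : ℂ → F} {c : ℂ}
    {R m : ℝ} (hR : 0 < R) (hm : ∀ z ∈ ball c R, ‖f z‖ ≤ m) :
    MapsTo f (ball c R) (closedBall (f c) (2 * m)) := by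
  intro z hz
  rw [mem_closedBall, dist_eq_norm]
  linarith [norm_sub_le (f z) (f c), hm z hz, hm c (mem_ball_self hR)]

variable {F : Type*} [NormedAddCommGroup F] [NormedSpace ℂ F] {f : ℂ → F} {c z w : ℂ} {R m : ℝ}

theorem norm_sub_le_of_norm_le_ball (hR : 0 < R) (hd : DifferentiableOn ℂ f (ball c R))
    (hm : ∀ z ∈ ball c R, ‖f z‖ ≤ m) (hz : z ∈ ball c R) :
    ‖f z - f c‖ ≤ 2 * m / R * ‖z - c‖ := by
  simpa [dist_eq_norm] using Complex.dist_le_div_mul_dist_of_mapsTo_ball hd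
    (mapsTo_closedBall_of_norm_le hR hm) hz

theorem norm_deriv_le_of_norm_le_ball (hR : 0 < R) (hd : DifferentiableOn ℂ f (ball c R))
    (hm : ∀ z ∈ ball c R, ‖f z‖ ≤ m) : ‖deriv f c‖ ≤ 2 * m / R :=
  Complex.norm_deriv_le_div_of_mapsTo_ball hd (mapsTo_closedBall_of_norm_le hR hm) hR

theorem norm_dslope_le_of_norm_le_ball (hR : 0 < R) (hd : DifferentiableOn ℂ f (ball c R))
    (hm : ∀ z ∈ ball c R, ‖f z‖ ≤ m) (hz : z ∈ ball c R) : ‖dslope f c z‖ ≤ 2 * m / R :=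
  Complex.norm_dslope_le_div_of_mapsTo_ball hd (mapsTo_closedBall_of_norm_le hR hm) hz

theorem norm_slope_le_of_norm_le_ball (hR : 0 < R) (hd : DifferentiableOn ℂ f (ball c R))
    (hm : ∀ z ∈ ball c R, ‖f z‖ ≤ m) (hz : z ∈ ball c R) (hzc : z ≠ c) :
    ‖slope f c z‖ ≤ 2 * m / R := by
  simpa [dslope_of_ne f hzc] using norm_dslope_le_of_norm_le_ball hR hd hm hz

theorem norm_slope_sub_slope_le_of_norm_le_ball [CompleteSpace F] (hR : 0 < R)
    (hd : DifferentiableOn ℂ f (ball c R)) (hm : ∀ z ∈ ball c R, ‖f z‖ ≤ m)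
    (hz : z ∈ ball c R) (hw : w ∈ ball c R) (hzc : z ≠ c) (hwc : w ≠ c) :
    ‖slope f c z - slope f c w‖ ≤ 2 * (2 * m / R) / R * (‖z - c‖ + ‖w - c‖) := by
  have key : ∀ v ∈ ball c R, ‖dslope f c v - dslope f c c‖ ≤ 2 * (2 * m / R) / R * ‖v - c‖ :=
    fun v hv => norm_sub_le_of_norm_le_ball hR
      ((Complex.differentiableOn_dslope (ball_mem_nhds c hR)).2 hd)
      (fun u hu => norm_dslope_le_of_norm_le_ball hR hd hm hu) hv
  rw [← dslope_of_ne f hzc, ← dslope_of_ne f hwc, mul_add,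
    ← sub_sub_sub_cancel_right _ _ (dslope f c c)]
  exact (norm_sub_le _ _).trans (add_le_add (key z hz) (key w hw))

theorem aestronglyMeasurable_of_hasDerivAt {μ : Measure ℝ} {f : ℂ → ℝ → F} {f' : ℝ → F}
    (hR : 0 < R) (hf : ∀ z ∈ ball c R, AEStronglyMeasurable (f z) μ)
    (hf' : ∀ᵐ s ∂μ, HasDerivAt (fun z => f z s) (f' s) c) : AEStronglyMeasurable f' μ := by
  obtain ⟨u, hu⟩ := exists_seq_tendsto (𝓝[≠] c)
  have hmem : ∀ᶠ n in atTop, u n ∈ ball c R :=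
    (hu.mono_right nhdsWithin_le_nhds).eventually (ball_mem_nhds c hR)
  obtain ⟨N, hN⟩ := eventually_atTop.1 hmem
  refine aestronglyMeasurable_of_tendsto_ae atTop
    (f := fun n s => slope (fun z => f z s) c (u (n + N))) (fun n => ?_) ?_
  · simp only [slope_def_module]
    exact ((hf _ (hN _ (by omega))).sub (hf _ (mem_ball_self hR))).const_smul _
  · filter_upwards [hf'] with s hs
    exact (hs.tendsto_slope.comp hu).comp (tendsto_add_atTop_nat N)

theorem differentiableAt_of_norm_slope_sub_slope_le [CompleteSpace F] {C : ℝ} (hR : 0 < R)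
    (h : ∀ z ∈ ball c R, ∀ w ∈ ball c R, z ≠ c → w ≠ c →
      ‖slope f c z - slope f c w‖ ≤ C * (‖z - c‖ + ‖w - c‖)) : DifferentiableAt ℂ f c := by
  have hcauchy : Cauchy (map (slope f c) (𝓝[≠] c)) := by
    rw [cauchy_map_iff', tendsto_uniformity_iff_dist_tendsto_zero]
    have hlim : Tendsto (fun p : ℂ × ℂ => C * (‖p.1 - c‖ + ‖p.2 - c‖))
        (𝓝[≠] c ×ˢ 𝓝[≠] c) (𝓝 0) := by
      have h0 : Tendsto (fun p : ℂ × ℂ => C * (‖p.1 - c‖ + ‖p.2 - c‖)) (𝓝 (c, c)) (𝓝 0) := by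
        have : Continuous (fun p : ℂ × ℂ => C * (‖p.1 - c‖ + ‖p.2 - c‖)) := by fun_prop
        simpa using this.tendsto (c, c)
      refine h0.mono_left ?_
      rw [nhds_prod_eq]
      exact prod_mono nhdsWithin_le_nhds nhdsWithin_le_nhds
    have hev : ∀ᶠ z in 𝓝[≠] c, z ∈ ball c R ∧ z ≠ c :=
      (eventually_nhdsWithin_of_eventually_nhds (ball_mem_nhds c hR)).and self_mem_nhdsWithin
    refine squeeze_zero' (Eventually.of_forall fun _ => dist_nonneg) ?_ hlim
    filter_upwards [hev.prod_mk hev] with p hp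
    rw [dist_eq_norm]
    exact h _ hp.1.1 _ hp.2.1 hp.1.2 hp.2.2
  obtain ⟨l, hl⟩ := cauchy_map_iff_exists_tendsto.1 hcauchy
  exact (hasDerivAt_iff_tendsto_slope.2 hl).differentiableAt

end Slope

section Volterra

variable {E : Type*} [NormedAddCommGroup E] [NormedSpace ℂ E] {T q : ℝ}

theorem norm_le_of_volterra_contraction {k : ℝ → ℝ → E →L[ℂ] E} {y : ℝ → E} {C : ℝ} (hq : q < 1)
    (hk : ∀ t ∈ Ici T, IntegrableOn (fun s => ‖k t s‖) (Ioi t))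
    (hkq : ∀ t ∈ Ici T, ∫ s in Ioi t, ‖k t s‖ ≤ q) (hy : ∃ M, ∀ t ∈ Ici T, ‖y t‖ ≤ M)
    (h : ∀ t ∈ Ici T, ‖y t + ∫ s in Ioi t, k t s (y s)‖ ≤ C) :
    ∀ t ∈ Ici T, ‖y t‖ ≤ C / (1 - q) := by
  obtain ⟨M, hM⟩ := hy
  have hbdd : BddAbove ((fun t => ‖y t‖) '' Ici T) := ⟨M, by rintro _ ⟨t, ht, rfl⟩; exact hM t ht⟩
  set S := sSup ((fun t => ‖y t‖) '' Ici T)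
  have hyS : ∀ t ∈ Ici T, ‖y t‖ ≤ S := fun t ht => le_csSup hbdd ⟨t, ht, rfl⟩
  have hS0 : 0 ≤ S := (norm_nonneg _).trans (hyS T self_mem_Ici)
  have hstep : ∀ t ∈ Ici T, ‖y t‖ ≤ C + q * S := by
    intro t ht
    have hint : ‖∫ s in Ioi t, k t s (y s)‖ ≤ q * S := by
      refine (norm_integral_le_of_norm_le ((hk t ht).mul_const S) ?_).trans ?_
      · refine (ae_restrict_iff' measurableSet_Ioi).2 (Eventually.of_forall fun s hs => ?_)
        exact (k t s).le_opNorm_of_le (hyS s (Ici_subset_Ici.2 ht (Ioi_subset_Ici_self hs)))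
      · rw [integral_mul_const]
        exact mul_le_mul_of_nonneg_right (hkq t ht) hS0
    have := norm_sub_le (y t + ∫ s in Ioi t, k t s (y s)) (∫ s in Ioi t, k t s (y s))
    rw [add_sub_cancel_right] at this
    linarith [h t ht]
  have hSle : S ≤ C + q * S :=
    csSup_le ⟨_, T, self_mem_Ici, rfl⟩ (by rintro _ ⟨t, ht, rfl⟩; exact hstep t ht)
  intro t ht
  refine (hyS t ht).trans ?_
  rw [le_div_iff₀ (by linarith)]
  linarith

/-- A family of Volterra equations at infinity on `[T, ∞)`, with data `(a, k)` holomorphic in the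
parameter on the disc `ball c R`, `a` uniformly bounded, `k` dominated by an integrable function
and uniformly contractive; `x` is a family of bounded solutions. -/
structure IsHolomorphicVolterraFamily (T : ℝ) (c : ℂ) (R : ℝ) (a : ℝ → ℂ → E)
    (k : ℝ → ℝ → ℂ → E →L[ℂ] E) (x : ℝ → ℂ → E) (Ma : ℝ) (G : ℝ → ℝ) (q : ℝ) : Prop where
  radius_pos : 0 < R
  lt_one : q < 1
  data_diff : ∀ t ∈ Ici T, DifferentiableOn ℂ (a t) (ball c R)
  data_le : ∀ t ∈ Ici T, ∀ z ∈ ball c R, ‖a t z‖ ≤ Ma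
  kernel_diff : ∀ t ∈ Ici T, ∀ s ∈ Ioi t, DifferentiableOn ℂ (k t s) (ball c R)
  kernel_le : ∀ t ∈ Ici T, ∀ s ∈ Ioi t, ∀ z ∈ ball c R, ‖k t s z‖ ≤ G s
  bound_int : IntegrableOn G (Ioi T)
  kernel_meas : ∀ t ∈ Ici T, ∀ z ∈ ball c R,
    AEStronglyMeasurable (fun s => k t s z) (volume.restrict (Ioi t))
  kernel_lam : ∀ t ∈ Ici T, ∀ z ∈ ball c R, ∫ s in Ioi t, ‖k t s z‖ ≤ q
  sol_meas : ∀ t ∈ Ici T, ∀ z ∈ ball c R,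
    AEStronglyMeasurable (fun s => x s z) (volume.restrict (Ioi t))
  sol_bdd : ∀ z ∈ ball c R, ∃ M, ∀ t ∈ Ici T, ‖x t z‖ ≤ M
  sol_eq : ∀ z ∈ ball c R, ∀ t ∈ Ici T, x t z = a t z - ∫ s in Ioi t, k t s z (x s z)

theorem ae_restrict_Ioi_of_forall {p : ℝ → Prop} {t : ℝ} (h : ∀ s ∈ Ioi t, p s) :
    ∀ᵐ s ∂volume.restrict (Ioi t), p s :=
  (ae_restrict_iff' measurableSet_Ioi).2 (Eventually.of_forall h)

theorem norm_setIntegral_Ioi_le {F : Type*} [NormedAddCommGroup F] [NormedSpace ℝ F]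
    {g : ℝ → ℝ} {f : ℝ → F} {D t : ℝ} (ht : t ∈ Ici T)
    (hg : IntegrableOn g (Ioi T)) (hg0 : ∀ s ∈ Ioi T, 0 ≤ g s) (hD : 0 ≤ D)
    (hf : ∀ s ∈ Ioi t, ‖f s‖ ≤ D * g s) :
    ‖∫ s in Ioi t, f s‖ ≤ D * ∫ s in Ioi T, g s := by
  refine (norm_integral_le_of_norm_le ((hg.mono_set (Ioi_subset_Ioi ht)).const_mul D)
    (ae_restrict_Ioi_of_forall hf)).trans ?_
  rw [integral_const_mul]
  exact mul_le_mul_of_nonneg_left (setIntegral_mono_set hg (ae_restrict_Ioi_of_forall hg0)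
    (Ioi_subset_Ioi ht).eventuallyLE) hD

theorem integrableOn_clm_apply {L : ℝ → E →L[ℂ] E} {y : ℝ → E} {g : ℝ → ℝ} {t M : ℝ}
    (hg : IntegrableOn g (Ioi t)) (hL : AEStronglyMeasurable L (volume.restrict (Ioi t)))
    (hLg : ∀ s ∈ Ioi t, ‖L s‖ ≤ g s) (hy : AEStronglyMeasurable y (volume.restrict (Ioi t)))
    (hyM : ∀ s ∈ Ioi t, ‖y s‖ ≤ M) : IntegrableOn (fun s => L s (y s)) (Ioi t) :=
  (hg.mul_const M).mono' ((ContinuousLinearMap.id ℂ (E →L[ℂ] E)).aestronglyMeasurable_comp₂ hL hy)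
    (ae_restrict_Ioi_of_forall fun s hs => (L s).le_of_opNorm_le_of_le (hLg s hs) (hyM s hs))

namespace IsHolomorphicVolterraFamily

variable {c : ℂ} {R Ma : ℝ} {a x : ℝ → ℂ → E} {k : ℝ → ℝ → ℂ → E →L[ℂ] E} {G : ℝ → ℝ}

theorem center_mem (h : IsHolomorphicVolterraFamily T c R a k x Ma G q) : c ∈ ball c R :=
  mem_ball_self h.radius_pos

theorem bound_nonneg (h : IsHolomorphicVolterraFamily T c R a k x Ma G q) :
    ∀ s ∈ Ioi T, 0 ≤ G s := fun s hs =>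
  (norm_nonneg _).trans (h.kernel_le T self_mem_Ici s hs c h.center_mem)

theorem bound_int_Ioi (h : IsHolomorphicVolterraFamily T c R a k x Ma G q) {t : ℝ}
    (ht : t ∈ Ici T) : IntegrableOn G (Ioi t) :=
  h.bound_int.mono_set (Ioi_subset_Ioi ht)

theorem integral_bound_nonneg (h : IsHolomorphicVolterraFamily T c R a k x Ma G q) :
    0 ≤ ∫ s in Ioi T, G s :=
  setIntegral_nonneg measurableSet_Ioi h.bound_nonneg

theorem kernel_norm_int (h : IsHolomorphicVolterraFamily T c R a k x Ma G q) {z : ℂ}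
    (hz : z ∈ ball c R) : ∀ t ∈ Ici T, IntegrableOn (fun s => ‖k t s z‖) (Ioi t) := fun t ht =>
  ((h.bound_int_Ioi ht).mono' (h.kernel_meas t ht z hz)
    (ae_restrict_Ioi_of_forall fun s hs => h.kernel_le t ht s hs z hz)).norm

theorem integrable_kernel_apply (h : IsHolomorphicVolterraFamily T c R a k x Ma G q) {z w : ℂ}
    (hz : z ∈ ball c R) (hw : w ∈ ball c R) {t : ℝ} (ht : t ∈ Ici T) :
    IntegrableOn (fun s => k t s z (x s w)) (Ioi t) := by
  obtain ⟨M, hM⟩ := h.sol_bdd w hw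
  exact integrableOn_clm_apply (h.bound_int_Ioi ht) (h.kernel_meas t ht z hz)
    (fun s hs => h.kernel_le t ht s hs z hz) (h.sol_meas t ht w hw)
    (fun s hs => hM s (Ici_subset_Ici.2 ht (Ioi_subset_Ici_self hs)))

theorem sol_le (h : IsHolomorphicVolterraFamily T c R a k x Ma G q) {z : ℂ}
    (hz : z ∈ ball c R) : ∀ t ∈ Ici T, ‖x t z‖ ≤ Ma / (1 - q) := by
  refine norm_le_of_volterra_contraction h.lt_one (h.kernel_norm_int hz)
    (fun t ht => h.kernel_lam t ht z hz) (h.sol_bdd z hz) fun t ht => ?_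
  rw [h.sol_eq z hz t ht, sub_add_cancel]
  exact h.data_le t ht z hz

theorem integrable_slope_kernel_apply (h : IsHolomorphicVolterraFamily T c R a k x Ma G q)
    {z : ℂ} (hz : z ∈ ball c R) {t : ℝ} (ht : t ∈ Ici T) :
    IntegrableOn (fun s => slope (k t s) c z (x s z)) (Ioi t) := by
  simp only [slope_def_module, smul_apply, sub_apply]
  exact ((h.integrable_kernel_apply hz hz ht).sub
    (h.integrable_kernel_apply h.center_mem hz ht)).smul _

theorem integrable_kernel_apply_slope (h : IsHolomorphicVolterraFamily T c R a k x Ma G q)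
    {z : ℂ} (hz : z ∈ ball c R) {t : ℝ} (ht : t ∈ Ici T) :
    IntegrableOn (fun s => k t s c (slope (x s) c z)) (Ioi t) := by
  simp only [slope_def_module, map_smul, map_sub]
  exact ((h.integrable_kernel_apply h.center_mem hz ht).sub
    (h.integrable_kernel_apply h.center_mem h.center_mem ht)).smul _

/-- Difference quotients of the solution solve a Volterra equation with kernel `k · · c`. -/
theorem slope_eq (h : IsHolomorphicVolterraFamily T c R a k x Ma G q) {z : ℂ}
    (hz : z ∈ ball c R) {t : ℝ} (ht : t ∈ Ici T) :
    slope (x t) c z + ∫ s in Ioi t, k t s c (slope (x s) c z) =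
      slope (a t) c z - ∫ s in Ioi t, slope (k t s) c z (x s z) := by
  rw [← eq_sub_iff_add_eq, sub_sub, ← integral_add (h.integrable_slope_kernel_apply hz ht)
    (h.integrable_kernel_apply_slope hz ht)]
  have hpt : ∀ s, slope (k t s) c z (x s z) + k t s c (slope (x s) c z) =
      (z - c)⁻¹ • (k t s z (x s z) - k t s c (x s c)) := by
    intro s
    simp only [slope_def_module, smul_apply, sub_apply,
      map_smul, map_sub, ← smul_add, sub_add_sub_cancel]
  simp only [hpt]
  rw [integral_smul, integral_sub (h.integrable_kernel_apply hz hz ht)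
    (h.integrable_kernel_apply h.center_mem h.center_mem ht), slope_def_module, slope_def_module,
    h.sol_eq z hz t ht, h.sol_eq c h.center_mem t ht, ← smul_sub]
  congr 1
  abel

theorem exists_slope_bound (h : IsHolomorphicVolterraFamily T c R a k x Ma G q) {z : ℂ}
    (hz : z ∈ ball c R) : ∃ M, ∀ t ∈ Ici T, ‖slope (x t) c z‖ ≤ M := by
  refine ⟨‖(z - c)⁻¹‖ * (Ma / (1 - q) + Ma / (1 - q)), fun t ht => ?_⟩
  rw [slope_def_module, norm_smul]
  gcongr
  exact (norm_sub_le _ _).trans (add_le_add (h.sol_le hz t ht) (h.sol_le h.center_mem t ht))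

theorem sol_bound_nonneg (h : IsHolomorphicVolterraFamily T c R a k x Ma G q) :
    0 ≤ Ma / (1 - q) :=
  (norm_nonneg _).trans (h.sol_le h.center_mem T self_mem_Ici)

theorem exists_uniform_slope_bound (h : IsHolomorphicVolterraFamily T c R a k x Ma G q) :
    ∃ L, 0 ≤ L ∧ ∀ z ∈ ball c R, z ≠ c → ∀ t ∈ Ici T, ‖slope (x t) c z‖ ≤ L := by
  have hR := h.radius_pos
  have hM := h.sol_bound_nonneg
  set M := Ma / (1 - q)
  set L := (2 * Ma / R + 2 / R * M * ∫ s in Ioi T, G s) / (1 - q)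
  have hle : ∀ z ∈ ball c R, z ≠ c → ∀ t ∈ Ici T, ‖slope (x t) c z‖ ≤ L := by
    intro z hz hzc
    refine norm_le_of_volterra_contraction h.lt_one (h.kernel_norm_int h.center_mem)
      (fun t ht => h.kernel_lam t ht c h.center_mem) (h.exists_slope_bound hz) fun t ht => ?_
    rw [h.slope_eq hz ht]
    refine (norm_sub_le _ _).trans (add_le_add
      (norm_slope_le_of_norm_le_ball hR (h.data_diff t ht) (h.data_le t ht) hz hzc)
      (norm_setIntegral_Ioi_le ht h.bound_int h.bound_nonneg (by positivity) fun s hs => ?_))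
    refine ((slope (k t s) c z).le_of_opNorm_le_of_le (norm_slope_le_of_norm_le_ball hR
      (h.kernel_diff t ht s hs) (h.kernel_le t ht s hs) hz hzc)
      (h.sol_le hz s (Ici_subset_Ici.2 ht (Ioi_subset_Ici_self hs)))).trans_eq ?_
    ring
  exact ⟨max L 0, le_max_right _ _,
    fun z hz hzc t ht => (hle z hz hzc t ht).trans (le_max_left _ _)⟩

theorem norm_sol_sub_le {L : ℝ}
    (hL : ∀ z ∈ ball c R, z ≠ c → ∀ t ∈ Ici T, ‖slope (x t) c z‖ ≤ L) {z : ℂ}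
    (hz : z ∈ ball c R) (hzc : z ≠ c) {t : ℝ} (ht : t ∈ Ici T) :
    ‖x t z - x t c‖ ≤ L * ‖z - c‖ := by
  have h1 := hL z hz hzc t ht
  have hpos : 0 < ‖z - c‖ := norm_pos_iff.2 (sub_ne_zero.2 hzc)
  rwa [slope_def_module, norm_smul, norm_inv, inv_mul_le_iff₀ hpos, mul_comm] at h1

/-- The difference quotients of the solution at the centre are Lipschitz there, uniformly in `t`. -/
theorem exists_slope_sub_slope_bound [CompleteSpace E]
    (h : IsHolomorphicVolterraFamily T c R a k x Ma G q) :
    ∃ C, ∀ z ∈ ball c R, ∀ w ∈ ball c R, z ≠ c → w ≠ c → ∀ t ∈ Ici T,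
      ‖slope (x t) c z - slope (x t) c w‖ ≤ C * (‖z - c‖ + ‖w - c‖) := by
  have hR := h.radius_pos
  have hM := h.sol_bound_nonneg
  have hI := h.integral_bound_nonneg
  obtain ⟨L, hL0, hL⟩ := h.exists_uniform_slope_bound
  set M := Ma / (1 - q)
  refine ⟨(2 * (2 * Ma / R) / R + (2 * (2 / R) / R * M + 2 / R * L) * ∫ s in Ioi T, G s) / (1 - q),
    fun z hz w hw hzc hwc => ?_⟩
  set d := ‖z - c‖ + ‖w - c‖ with hd
  have hd0 : 0 ≤ d := by positivity
  rw [div_mul_eq_mul_div]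
  refine norm_le_of_volterra_contraction (y := fun t => slope (x t) c z - slope (x t) c w)
    h.lt_one (h.kernel_norm_int h.center_mem)
    (fun t ht => h.kernel_lam t ht c h.center_mem) ⟨L + L, fun t ht => (norm_sub_le _ _).trans
      (add_le_add (hL z hz hzc t ht) (hL w hw hwc t ht))⟩ fun t ht => ?_
  simp only [map_sub]
  rw [integral_sub (h.integrable_kernel_apply_slope hz ht) (h.integrable_kernel_apply_slope hw ht),
    ← add_sub_add_comm, h.slope_eq hz ht, h.slope_eq hw ht, sub_sub_sub_comm,
    ← integral_sub (h.integrable_slope_kernel_apply hz ht) (h.integrable_slope_kernel_apply hw ht),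
    add_mul, mul_right_comm _ (∫ s in Ioi T, G s)]
  refine (norm_sub_le _ _).trans (add_le_add
    (norm_slope_sub_slope_le_of_norm_le_ball hR (h.data_diff t ht) (h.data_le t ht) hz hw hzc hwc)
    (norm_setIntegral_Ioi_le ht h.bound_int h.bound_nonneg (by positivity) fun s hs => ?_))
  have hsT : s ∈ Ici T := Ici_subset_Ici.2 ht (Ioi_subset_Ici_self hs)
  have hG := h.bound_nonneg s (Ioi_subset_Ioi ht hs)
  have hkd := h.kernel_diff t ht s hs
  have hkG := h.kernel_le t ht s hs
  have hsplit : slope (k t s) c z (x s z) - slope (k t s) c w (x s w) =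
      (slope (k t s) c z - slope (k t s) c w) (x s z) +
        slope (k t s) c w ((x s z - x s c) - (x s w - x s c)) := by
    simp only [sub_apply, map_sub]
    abel
  rw [hsplit]
  have hxd : ‖(x s z - x s c) - (x s w - x s c)‖ ≤ L * d := by
    rw [hd, mul_add]
    exact (norm_sub_le _ _).trans
      (add_le_add (norm_sol_sub_le hL hz hzc hsT) (norm_sol_sub_le hL hw hwc hsT))
  refine (norm_add_le_of_le (ContinuousLinearMap.le_of_opNorm_le_of_le _
    (norm_slope_sub_slope_le_of_norm_le_ball hR hkd hkG hz hw hzc hwc) (h.sol_le hz s hsT))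
    (ContinuousLinearMap.le_of_opNorm_le_of_le _
      (norm_slope_le_of_norm_le_ball hR hkd hkG hw hwc) hxd)).trans_eq ?_
  rw [← hd]
  ring

theorem differentiableAt_sol [CompleteSpace E]
    (h : IsHolomorphicVolterraFamily T c R a k x Ma G q) {t : ℝ} (ht : t ∈ Ici T) :
    DifferentiableAt ℂ (x t) c := by
  obtain ⟨C, hC⟩ := h.exists_slope_sub_slope_bound
  exact differentiableAt_of_norm_slope_sub_slope_le h.radius_pos
    fun z hz w hw hzc hwc => hC z hz w hw hzc hwc t ht

theorem recenter (h : IsHolomorphicVolterraFamily T c R a k x Ma G q) {z : ℂ} {r : ℝ}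
    (hr : 0 < r) (hz : ball z r ⊆ ball c R) :
    IsHolomorphicVolterraFamily T z r a k x Ma G q where
  radius_pos := hr
  lt_one := h.lt_one
  data_diff t ht := (h.data_diff t ht).mono hz
  data_le t ht w hw := h.data_le t ht w (hz hw)
  kernel_diff t ht s hs := (h.kernel_diff t ht s hs).mono hz
  kernel_le t ht s hs w hw := h.kernel_le t ht s hs w (hz hw)
  bound_int := h.bound_int
  kernel_meas t ht w hw := h.kernel_meas t ht w (hz hw)
  kernel_lam t ht w hw := h.kernel_lam t ht w (hz hw)
  sol_meas t ht w hw := h.sol_meas t ht w (hz hw)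
  sol_bdd w hw := h.sol_bdd w (hz hw)
  sol_eq w hw := h.sol_eq w (hz hw)

theorem differentiableAt_sol_of_mem [CompleteSpace E]
    (h : IsHolomorphicVolterraFamily T c R a k x Ma G q) {z : ℂ} (hz : z ∈ ball c R) {t : ℝ}
    (ht : t ∈ Ici T) : DifferentiableAt ℂ (x t) z := by
  obtain ⟨r, hr, hsub⟩ := Metric.isOpen_iff.1 isOpen_ball z hz
  exact (h.recenter hr hsub).differentiableAt_sol ht

theorem norm_deriv_sol_le [CompleteSpace E]
    (h : IsHolomorphicVolterraFamily T c R a k x Ma G q) {t : ℝ} (ht : t ∈ Ici T) :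
    ‖deriv (x t) c‖ ≤ 2 * (Ma / (1 - q)) / R :=
  norm_deriv_le_of_norm_le_ball h.radius_pos
    (fun _ hz => (h.differentiableAt_sol_of_mem hz ht).differentiableWithinAt)
    fun _ hz => h.sol_le hz t ht

/-- The derivative of the solution solves the differentiated Volterra equation. -/
theorem deriv_sol_eq [CompleteSpace E]
    (h : IsHolomorphicVolterraFamily T c R a k x Ma G q) {t : ℝ} (ht : t ∈ Ici T) :
    deriv (x t) c = (deriv (a t) c - ∫ s in Ioi t, deriv (k t s) c (x s c))
      - ∫ s in Ioi t, k t s c (deriv (x s) c) := by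
  have hR := h.radius_pos
  have hnhds := ball_mem_nhds c hR
  have hmemT : ∀ s ∈ Ioi t, s ∈ Ici T := fun s hs => Ici_subset_Ici.2 ht (Ioi_subset_Ici_self hs)
  have hkd : ∀ s ∈ Ioi t, ∀ z ∈ ball c R, DifferentiableAt ℂ (k t s) z := fun s hs z hz =>
    (h.kernel_diff t ht s hs).differentiableAt (isOpen_ball.mem_nhds hz)
  have hxd : ∀ s ∈ Ioi t, ∀ z ∈ ball c R, DifferentiableAt ℂ (x s) z := fun s hs z hz =>
    h.differentiableAt_sol_of_mem hz (hmemT s hs)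
  have hFd : ∀ s ∈ Ioi t, ∀ z ∈ ball c R,
      DifferentiableAt ℂ (fun w => k t s w (x s w)) z := fun s hs z hz =>
    (hkd s hs z hz).clm_apply (hxd s hs z hz)
  have hhalf : ∀ z ∈ ball c (R / 2), ball z (R / 2) ⊆ ball c R := fun z hz =>
    ball_subset_ball' (by linarith [mem_ball.1 hz])
  have hsub : ball c (R / 2) ⊆ ball c R := ball_subset_ball (by linarith)
  have hderiv_int := (hasDerivAt_integral_of_dominated_loc_of_deriv_le
    (μ := volume.restrict (Ioi t)) (F := fun z s => k t s z (x s z))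
    (F' := fun z s => deriv (fun w => k t s w (x s w)) z)
    (bound := fun s => 2 * (G s * (Ma / (1 - q))) / (R / 2))
    (ball_mem_nhds c (half_pos hR))
    (by
      filter_upwards [hnhds] with z hz
      exact (h.integrable_kernel_apply hz hz ht).aestronglyMeasurable)
    (h.integrable_kernel_apply h.center_mem h.center_mem ht)
    (aestronglyMeasurable_of_hasDerivAt hR
      (fun z hz => (h.integrable_kernel_apply hz hz ht).aestronglyMeasurable)
      (ae_restrict_Ioi_of_forall fun s hs => (hFd s hs c h.center_mem).hasDerivAt))
    (ae_restrict_Ioi_of_forall fun s hs z hz =>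
      norm_deriv_le_of_norm_le_ball (half_pos hR)
        (fun w hw => (hFd s hs w (hhalf z hz hw)).differentiableWithinAt)
        fun w hw => (k t s w).le_of_opNorm_le_of_le
          (h.kernel_le t ht s hs w (hhalf z hz hw)) (h.sol_le (hhalf z hz hw) s (hmemT s hs)))
    ((((h.bound_int_Ioi ht).mul_const _).const_mul 2).div_const _)
    (ae_restrict_Ioi_of_forall fun s hs z hz => (hFd s hs z (hsub hz)).hasDerivAt)).2
  have hx : x t =ᶠ[𝓝 c] fun z => a t z - ∫ s in Ioi t, k t s z (x s z) := by
    filter_upwards [hnhds] with z hz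
    exact h.sol_eq z hz t ht
  have had : DifferentiableAt ℂ (a t) c := (h.data_diff t ht).differentiableAt hnhds
  have hk'x : IntegrableOn (fun s => deriv (k t s) c (x s c)) (Ioi t) :=
    integrableOn_clm_apply (((h.bound_int_Ioi ht).const_mul 2).div_const R)
      (aestronglyMeasurable_of_hasDerivAt (f := fun z s => k t s z) hR (h.kernel_meas t ht)
        (ae_restrict_Ioi_of_forall fun s hs => (hkd s hs c h.center_mem).hasDerivAt))
      (fun s hs => norm_deriv_le_of_norm_le_ball hR (h.kernel_diff t ht s hs)
        (h.kernel_le t ht s hs))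
      (h.sol_meas t ht c h.center_mem) fun s hs => h.sol_le h.center_mem s (hmemT s hs)
  have hkx' : IntegrableOn (fun s => k t s c (deriv (x s) c)) (Ioi t) :=
    integrableOn_clm_apply (h.bound_int_Ioi ht) (h.kernel_meas t ht c h.center_mem)
      (fun s hs => h.kernel_le t ht s hs c h.center_mem)
      (aestronglyMeasurable_of_hasDerivAt (f := fun z s => x s z) hR (h.sol_meas t ht)
        (ae_restrict_Ioi_of_forall fun s hs => (hxd s hs c h.center_mem).hasDerivAt))
      fun s hs => h.norm_deriv_sol_le (hmemT s hs)
  rw [hx.deriv_eq, (had.hasDerivAt.fun_sub hderiv_int).deriv, sub_sub, ← integral_add hk'x hkx']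
  congr 1
  refine setIntegral_congr_fun measurableSet_Ioi fun s hs => ?_
  exact ((hkd s hs c h.center_mem).hasDerivAt.clm_apply
    (hxd s hs c h.center_mem).hasDerivAt).deriv

end IsHolomorphicVolterraFamily

/-- A dominated holomorphic kernel which is contractive at one parameter value is uniformly
contractive nearby. -/
theorem exists_uniform_contraction {c : ℂ} {R l : ℝ} {k : ℝ → ℝ → ℂ → E →L[ℂ] E} {G : ℝ → ℝ}
    (hR : 0 < R) (hl : l < 1)
    (hd : ∀ t ∈ Ici T, ∀ s ∈ Ioi t, DifferentiableOn ℂ (k t s) (ball c R))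
    (hG : ∀ t ∈ Ici T, ∀ s ∈ Ioi t, ∀ z ∈ ball c R, ‖k t s z‖ ≤ G s)
    (hGint : IntegrableOn G (Ioi T))
    (hkint : ∀ t ∈ Ici T, ∀ z ∈ ball c R, IntegrableOn (fun s => ‖k t s z‖) (Ioi t))
    (hkl : ∀ t ∈ Ici T, ∫ s in Ioi t, ‖k t s c‖ ≤ l) :
    ∃ r, 0 < r ∧ r ≤ R ∧ ∃ q < 1, ∀ t ∈ Ici T, ∀ z ∈ ball c r, ∫ s in Ioi t, ‖k t s z‖ ≤ q := by
  have hc : c ∈ ball c R := mem_ball_self hR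
  have hG0 : ∀ s ∈ Ioi T, 0 ≤ G s := fun s hs =>
    (norm_nonneg _).trans (hG T self_mem_Ici s hs c hc)
  set I := ∫ s in Ioi T, G s
  have hle : ∀ t ∈ Ici T, ∀ z ∈ ball c R,
      ∫ s in Ioi t, ‖k t s z‖ ≤ l + 2 / R * ‖z - c‖ * I := by
    intro t ht z hz
    have hdiff : ‖∫ s in Ioi t, (‖k t s z‖ - ‖k t s c‖)‖ ≤ 2 / R * ‖z - c‖ * I := by
      refine norm_setIntegral_Ioi_le ht hGint hG0 (by positivity) fun s hs => ?_
      refine (abs_norm_sub_norm_le _ _).trans ((norm_sub_le_of_norm_le_ball hR (hd t ht s hs)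
        (hG t ht s hs) hz).trans_eq ?_)
      ring
    rw [integral_sub (hkint t ht z hz) (hkint t ht c hc)] at hdiff
    linarith [hkl t ht, (le_abs_self _).trans hdiff]
  have hcont : Continuous fun z : ℂ => l + 2 / R * ‖z - c‖ * I := by fun_prop
  have hev : ∀ᶠ z in 𝓝 c, l + 2 / R * ‖z - c‖ * I < (1 + l) / 2 :=
    (hcont.tendsto c).eventually_lt_const (by simp; linarith)
  obtain ⟨r, hr, hball⟩ := Metric.eventually_nhds_iff_ball.1 hev
  exact ⟨min r R, lt_min hr hR, min_le_right _ _, (1 + l) / 2, by linarith, fun t ht z hz =>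
    (hle t ht z (ball_subset_ball (min_le_right _ _) hz)).trans
      (hball z (ball_subset_ball (min_le_left _ _) hz)).le⟩

end Volterra

/-- Holomorphic dependence, Theorem 5.13 of the paper. For data
`(a(·,ε), K_ε)` of the Volterra integral equation at infinity depending on a
complex parameter `ε ∈ U ⊆ ℂ`, with `a` bounded, continuous in `t` and holomorphic
in `ε`, and the kernel of holomorphic product type `K(t,s,ε) = A(t,s,ε)·B(s,ε)`
(`A`, `B` holomorphic in `ε`, `‖A‖` bounded, `B` integrally bounded, `λ(K_ε) < 1`),
the bounded solution `x(t, ·)` is holomorphic on `U` for each `t`, its derivative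
`∂_ε x(·,ε)` is bounded, and it solves the differentiated Volterra equation. -/
theorem volterra_at_infinity_holomorphic_dependence
    (T : ℝ) (n : ℕ) (hn : 1 ≤ n) (U : Set ℂ) (hU : IsOpen U)
    -- the inhomogeneity `a`, bounded, continuous in `t`, holomorphic in `ε`
    (a a' : ℝ → ℂ → EuclideanSpace ℂ (Fin n))
    (Ma : ℝ) (ha_bdd : ∀ t ∈ Ici T, ∀ ε ∈ U, ‖a t ε‖ ≤ Ma)
    (ha_cont : ∀ ε ∈ U, ContinuousOn (fun t => a t ε) (Ici T))
    (ha_deriv : ∀ t ∈ Ici T, ∀ ε ∈ U, HasDerivWithinAt (fun e => a t e) (a' t ε) U ε)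
    -- the kernel, of holomorphic product type `K(t,s,ε) = A(t,s,ε)·B(s,ε)`
    (A A' : ℝ → ℝ → ℂ → EuclideanSpace ℂ (Fin n) →L[ℂ] EuclideanSpace ℂ (Fin n))
    (B B' : ℝ → ℂ → EuclideanSpace ℂ (Fin n) →L[ℂ] EuclideanSpace ℂ (Fin n))
    (hK_cont : ∀ ε ∈ U, ContinuousOn
      (fun p : ℝ × ℝ => (A p.1 p.2 ε).comp (B p.2 ε)) {p : ℝ × ℝ | T ≤ p.1 ∧ p.1 ≤ p.2})
    (hK_int : ∀ ε ∈ U, ∀ t ∈ Ici T,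
      IntegrableOn (fun s => ‖(A t s ε).comp (B s ε)‖) (Ioi t))
    (lam : ℂ → ℝ) (hlam : ∀ ε ∈ U, lam ε < 1)
    (hK_lam : ∀ ε ∈ U, ∀ t ∈ Ici T, (∫ s in Ioi t, ‖(A t s ε).comp (B s ε)‖) ≤ lam ε)
    (hA_deriv : ∀ t s : ℝ, T ≤ t → t ≤ s → ∀ ε ∈ U,
      HasDerivWithinAt (fun e => A t s e) (A' t s ε) U ε)
    (CA : ℝ) (hA_bdd : ∀ t s : ℝ, T ≤ t → t ≤ s → ∀ ε ∈ U, ‖A t s ε‖ ≤ CA)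
    (hB_deriv : ∀ s ∈ Ici T, ∀ ε ∈ U, HasDerivWithinAt (fun e => B s e) (B' s ε) U ε)
    (hB_ib : IntegrallyBoundedC T U B)
    -- the unique bounded solution for each parameter value
    (x : ℝ → ℂ → EuclideanSpace ℂ (Fin n))
    (hx_bdd : ∀ ε ∈ U, ∃ M : ℝ, ∀ t ∈ Ici T, ‖x t ε‖ ≤ M)
    (hx_cont : ∀ ε ∈ U, ContinuousOn (fun t => x t ε) (Ici T))
    (hx_eq : ∀ ε ∈ U, ∀ t ∈ Ici T,
      x t ε = a t ε - ∫ s in Ioi t, (A t s ε).comp (B s ε) (x s ε)) :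
    (∀ t ∈ Ici T, DifferentiableOn ℂ (fun e => x t e) U) ∧
    ∃ x₁ : ℝ → ℂ → EuclideanSpace ℂ (Fin n),
      (∀ t ∈ Ici T, ∀ ε ∈ U, HasDerivWithinAt (fun e => x t e) (x₁ t ε) U ε) ∧
      (∀ ε ∈ U, ∃ M : ℝ, ∀ t ∈ Ici T, ‖x₁ t ε‖ ≤ M) ∧
      (∀ ε ∈ U, ∀ t ∈ Ici T,
        x₁ t ε = (a' t ε - ∫ s in Ioi t,
            ((A' t s ε).comp (B s ε) + (A t s ε).comp (B' s ε)) (x s ε))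
          - ∫ s in Ioi t, (A t s ε).comp (B s ε) (x₁ s ε)) := by
  have hU_nhds : ∀ ε ∈ U, U ∈ 𝓝 ε := fun ε hε => hU.mem_nhds hε
  have hA : ∀ t s : ℝ, T ≤ t → t ≤ s → ∀ ε ∈ U, HasDerivAt (A t s) (A' t s ε) ε :=
    fun t s ht hs ε hε => (hA_deriv t s ht hs ε hε).hasDerivAt (hU_nhds ε hε)
  have hB : ∀ s ∈ Ici T, ∀ ε ∈ U, HasDerivAt (B s) (B' s ε) ε :=
    fun s hs ε hε => (hB_deriv s hs ε hε).hasDerivAt (hU_nhds ε hε)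
  have ha : ∀ t ∈ Ici T, ∀ ε ∈ U, HasDerivAt (a t) (a' t ε) ε :=
    fun t ht ε hε => (ha_deriv t ht ε hε).hasDerivAt (hU_nhds ε hε)
  set k : ℝ → ℝ → ℂ → EuclideanSpace ℂ (Fin n) →L[ℂ] EuclideanSpace ℂ (Fin n) :=
    fun t s ε => (A t s ε).comp (B s ε)
  have hk : ∀ t ∈ Ici T, ∀ s ∈ Ioi t, ∀ ε ∈ U,
      HasDerivAt (k t s) ((A' t s ε).comp (B s ε) + (A t s ε).comp (B' s ε)) ε :=
    fun t ht s hs ε hε => (hA t s ht (le_of_lt hs) ε hε).clm_comp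
      (hB s (Ici_subset_Ici.2 ht (Ioi_subset_Ici_self hs)) ε hε)
  have hk_meas : ∀ t ∈ Ici T, ∀ ε ∈ U,
      AEStronglyMeasurable (fun s => k t s ε) (volume.restrict (Ioi t)) := fun t ht ε hε =>
    ((hK_cont ε hε).comp (f := fun s : ℝ => (t, s)) (by fun_prop)
      fun s hs => ⟨ht, le_of_lt hs⟩).aestronglyMeasurable measurableSet_Ioi
  have family : ∀ ε ∈ U, ∃ R G q, IsHolomorphicVolterraFamily T ε R a k x Ma G q := by
    intro ε hε
    obtain ⟨V, hV, hεV, hVU, g, hg0, -, hg_int, hBg⟩ := hB_ib ε hε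
    obtain ⟨R, hR, hRV⟩ := Metric.isOpen_iff.1 hV ε hεV
    have hCA : 0 ≤ CA := (norm_nonneg _).trans (hA_bdd T T le_rfl le_rfl ε hε)
    have hRU : ball ε R ⊆ U := hRV.trans hVU
    have hkd : ∀ t ∈ Ici T, ∀ s ∈ Ioi t, DifferentiableOn ℂ (k t s) (ball ε R) :=
      fun t ht s hs z hz => (hk t ht s hs z (hRU hz)).differentiableAt.differentiableWithinAt
    have hkG : ∀ t ∈ Ici T, ∀ s ∈ Ioi t, ∀ z ∈ ball ε R, ‖k t s z‖ ≤ CA * g s :=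
      fun t ht s hs z hz => (ContinuousLinearMap.opNorm_comp_le _ _).trans
        (mul_le_mul (hA_bdd t s ht (le_of_lt hs) z (hRU hz))
          (hBg z (hRV hz) s (Ici_subset_Ici.2 ht (Ioi_subset_Ici_self hs))) (norm_nonneg _) hCA)
    have hG_int : IntegrableOn (fun s => CA * g s) (Ioi T) :=
      (hg_int.mono_set Ioi_subset_Ici_self).const_mul CA
    obtain ⟨r, hr, hrR, q, hq, hkq⟩ := exists_uniform_contraction hR (hlam ε hε) hkd hkG hG_int
      (fun t ht z hz => hK_int z (hRU hz) t ht) (hK_lam ε hε)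
    have hsub : ball ε r ⊆ ball ε R := ball_subset_ball hrR
    have hrU : ball ε r ⊆ U := hsub.trans hRU
    exact ⟨r, fun s => CA * g s, q,
      { radius_pos := hr
        lt_one := hq
        data_diff := fun t ht z hz =>
          (ha t ht z (hrU hz)).differentiableAt.differentiableWithinAt
        data_le := fun t ht z hz => ha_bdd t ht z (hrU hz)
        kernel_diff := fun t ht s hs => (hkd t ht s hs).mono hsub
        kernel_le := fun t ht s hs z hz => hkG t ht s hs z (hsub hz)
        bound_int := hG_int
        kernel_meas := fun t ht z hz => hk_meas t ht z (hrU hz)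
        kernel_lam := hkq
        sol_meas := fun t ht z hz => ((hx_cont z (hrU hz)).mono
          (Ioi_subset_Ici_self.trans (Ici_subset_Ici.2 ht))).aestronglyMeasurable measurableSet_Ioi
        sol_bdd := fun z hz => hx_bdd z (hrU hz)
        sol_eq := fun z hz => hx_eq z (hrU hz) }⟩
  have hx_diff : ∀ t ∈ Ici T, ∀ ε ∈ U, DifferentiableAt ℂ (x t) ε := by
    intro t ht ε hε
    obtain ⟨R, G, q, h⟩ := family ε hε
    exact h.differentiableAt_sol ht
  refine ⟨fun t ht ε hε => (hx_diff t ht ε hε).differentiableWithinAt,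
    fun t ε => deriv (x t) ε, fun t ht ε hε => (hx_diff t ht ε hε).hasDerivAt.hasDerivWithinAt,
    fun ε hε => ?_, fun ε hε t ht => ?_⟩
  · obtain ⟨R, G, q, h⟩ := family ε hε
    exact ⟨_, fun t ht => h.norm_deriv_sol_le ht⟩
  · obtain ⟨R, G, q, h⟩ := family ε hε
    beta_reduce
    rw [h.deriv_sol_eq ht, (ha t ht ε hε).deriv]
    congr 2
    refine setIntegral_congr_fun measurableSet_Ioi fun s hs => ?_
    exact congrArg (fun L => L (x s ε)) (hk t ht s hs ε hε).deriv
end
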